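/- arXiv:2511.05087 — 4 statements merged into one kernel-verified Lean document; each statement's English description precedes it below -/
import Mathlib

section
/- Let H ∈ (0, 1/2). Then there exists a positive constant C, independent of T, such that for all T ≥ 1, |M(T)/(2T) − σ²| ≤ C/T, where σ² = H²Γ(2H)²σ_H², σ_H² = (4H−1)(1−1/cos(2Hπ)) for H ≠ 1/4 and σ_{1/4}² = 2/π. (Note that min(1, 3−4H) = 1 for H in this range.) -/
open Real MeasureTheory intervalIntegral

noncomputable def I1 (H T : ℝ) : ℝ :=
  ∫ t₁ in (0:ℝ)..T, ∫ t₂ in (0:ℝ)..T, ∫ s₁ in (0:ℝ)..T, ∫ s₂ in (0:ℝ)..T,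
    Real.exp (-|t₁ - s₁| - |t₂ - s₂|) * Real.sign (s₁ - t₁) * Real.sign (t₂ - s₂) *
      (Real.sign (t₂ - t₁) * |t₂ - t₁| ^ (2 * H - 1)) *
      (Real.sign (s₁ - s₂) * |s₁ - s₂| ^ (2 * H - 1))

noncomputable def I2 (H T : ℝ) : ℝ :=
  2 * ∫ t₁ in (0:ℝ)..T, ∫ t₂ in (0:ℝ)..T, ∫ s₁ in (0:ℝ)..T,
    Real.exp (-|t₁ - s₁| - t₂) * Real.sign (s₁ - t₁) *
      (Real.sign (t₂ - t₁) * |t₂ - t₁| ^ (2 * H - 1)) * s₁ ^ (2 * H - 1)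

noncomputable def I3 (H T : ℝ) : ℝ :=
  2 * (∫ u in (0:ℝ)..T, Real.exp (-u) * u ^ (2 * H - 1)) ^ 2 +
    2 * (Real.exp (-T) * ∫ u in (0:ℝ)..T, Real.exp u * u ^ (2 * H - 1)) ^ 2

/-- `fBmNormSqM H T` is the squared norm `‖f_T‖²` for `H ∈ (0,1/2)`. -/
noncomputable def fBmNormSqM (H T : ℝ) : ℝ := H ^ 2 * (I1 H T + 2 * I2 H T + I3 H T)

/-- `σ_H²`, with the value at `H = 1/4` interpreted as the limit `2/π`. -/
noncomputable def sigmaH2 (H : ℝ) : ℝ :=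
  if H = 1/4 then 2 / π else (4 * H - 1) * (1 - 1 / Real.cos (2 * H * π))

open Set

/-- A Beta integral on the half-line, after the substitution `u = x ^ 2`. -/
lemma integral_rpow_mul_one_add_sq_rpow {c s : ℝ} (hc : -1 < c) (hs : (c + 1) / 2 < s) :
    ∫ x in Ioi (0 : ℝ), x ^ c * (1 + x ^ 2) ^ (-s) =
      Real.Gamma ((c + 1) / 2) * Real.Gamma (s - (c + 1) / 2) / (2 * Real.Gamma s) := by
  have hs0 : 0 < s := by linarith
  have hG : 0 < Real.Gamma s := Real.Gamma_pos_of_pos hs0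
  have hG1 : 0 < Real.Gamma ((c + 1) / 2) := Real.Gamma_pos_of_pos (by linarith)
  have hG2 : 0 < Real.Gamma (s - (c + 1) / 2) := Real.Gamma_pos_of_pos (by linarith)
  let F : ℝ → ℝ → ℝ := fun x y => x ^ c * (y ^ (s - 1) * Real.exp (-((1 + x ^ 2) * y)))
  have hinner_y : ∀ x ∈ Ioi (0 : ℝ),
      ∫ y in Ioi (0 : ℝ), F x y = Real.Gamma s * (x ^ c * (1 + x ^ 2) ^ (-s)) := by
    intro x hx
    have h1 : (0 : ℝ) < 1 + x ^ 2 := by positivity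
    simp only [F]
    rw [MeasureTheory.integral_const_mul, Real.integral_rpow_mul_exp_neg_mul_Ioi hs0 h1,
      one_div, Real.inv_rpow h1.le, ← Real.rpow_neg h1.le]
    ring
  have hinner_x : ∀ y ∈ Ioi (0 : ℝ), ∫ x in Ioi (0 : ℝ), F x y =
      Real.Gamma ((c + 1) / 2) / 2 *
        (Real.exp (-y) * y ^ (s - (c + 1) / 2 - 1)) := by
    intro y hy
    have hy : (0 : ℝ) < y := hy
    have h := integral_rpow_mul_exp_neg_mul_rpow (p := 2) (q := c) (b := y) (by norm_num) hc hy
    have hF : ∀ x, F x y = y ^ (s - 1) * Real.exp (-y) *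
        (x ^ c * Real.exp (-y * x ^ (2 : ℝ))) := by
      intro x
      simp only [F]
      rw [show -((1 + x ^ 2) * y) = -y + -y * x ^ (2 : ℝ) by rw [Real.rpow_two]; ring,
        Real.exp_add]
      ring
    simp only [hF]
    rw [MeasureTheory.integral_const_mul, h,
      show s - (c + 1) / 2 - 1 = (s - 1) + -(c + 1) / 2 by ring, Real.rpow_add hy]
    ring
  have hFpos : ∀ x ∈ Ioi (0 : ℝ), ∀ y ∈ Ioi (0 : ℝ), 0 < F x y := fun x hx y hy =>
    mul_pos (Real.rpow_pos_of_pos hx _) (mul_pos (Real.rpow_pos_of_pos hy _) (Real.exp_pos _))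
  have hmeas : Measurable (Function.uncurry F) := by
    simp only [F, Function.uncurry_def]
    fun_prop
  have hint : Integrable (Function.uncurry F)
      ((volume.restrict (Ioi (0 : ℝ))).prod (volume.restrict (Ioi (0 : ℝ)))) := by
    rw [integrable_prod_iff' hmeas.aestronglyMeasurable]
    constructor
    · refine (ae_restrict_iff' measurableSet_Ioi).2 (.of_forall fun y hy => ?_)
      refine Integrable.of_integral_ne_zero ?_
      simp only [Function.uncurry_apply_pair]
      rw [hinner_x y hy]
      have := Real.rpow_pos_of_pos hy (s - (c + 1) / 2 - 1)
      positivity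
    · refine IntegrableOn.congr_fun (f := fun y => Real.Gamma ((c + 1) / 2) / 2 *
        (Real.exp (-y) * y ^ (s - (c + 1) / 2 - 1))) ?_ ?_ measurableSet_Ioi
      · exact (Real.GammaIntegral_convergent (by linarith)).const_mul _
      · intro y hy
        dsimp only
        rw [← hinner_x y hy]
        refine setIntegral_congr_fun measurableSet_Ioi fun x hx => ?_
        exact (Real.norm_of_nonneg (hFpos x hx y hy).le).symm
  have hswap := integral_integral_swap hint
  rw [setIntegral_congr_fun measurableSet_Ioi hinner_y,
    setIntegral_congr_fun measurableSet_Ioi hinner_x, MeasureTheory.integral_const_mul,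
    MeasureTheory.integral_const_mul, ← Real.Gamma_eq_integral (by linarith)] at hswap
  rw [eq_div_iff (by positivity)]
  linarith

lemma integral_rpow_div_one_add_sq {H : ℝ} (hH : H ∈ Ioo (0 : ℝ) (1 / 2)) :
    ∫ x in Ioi (0 : ℝ), x ^ (-(2 * H)) / (1 + x ^ 2) = π / (2 * Real.cos (π * H)) := by
  obtain ⟨h0, h1⟩ := hH
  have h := integral_rpow_mul_one_add_sq_rpow (c := -(2 * H)) (s := 1) (by linarith) (by linarith)
  have e : ∀ x : ℝ, x ^ (-(2 * H)) * (1 + x ^ 2) ^ (-(1 : ℝ)) = x ^ (-(2 * H)) / (1 + x ^ 2) := by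
    intro x
    rw [Real.rpow_neg_one, div_eq_mul_inv]
  simp only [e] at h
  rw [h, Real.Gamma_one, show 1 - (-(2 * H) + 1) / 2 = 1 - (1 / 2 - H) by ring,
    show (-(2 * H) + 1) / 2 = 1 / 2 - H by ring, Real.Gamma_mul_Gamma_one_sub,
    show π * (1 / 2 - H) = π / 2 - π * H by ring, Real.sin_pi_div_two_sub]
  field_simp

lemma integrableOn_rpow_div_one_add {H : ℝ} (hH : H ∈ Ioo (0 : ℝ) (1 / 2)) :
    IntegrableOn (fun x : ℝ => x ^ (-(2 * H)) / (1 + x)) (Ioi 0) := by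
  obtain ⟨h0, h1⟩ := hH
  have hm : Measurable (fun x : ℝ => x ^ (-(2 * H)) / (1 + x)) := by fun_prop
  rw [← Ioc_union_Ioi_eq_Ioi (zero_le_one (α := ℝ))]
  refine IntegrableOn.union ?_ ?_
  · have : IntegrableOn (fun x : ℝ => x ^ (-(2 * H))) (Ioc 0 1) :=
      (intervalIntegral.intervalIntegrable_rpow' (by linarith)).1
    refine Integrable.mono' this hm.aestronglyMeasurable ?_
    refine (ae_restrict_iff' measurableSet_Ioc).2 (.of_forall fun x hx => ?_)
    have hp := Real.rpow_pos_of_pos hx.1 (-(2 * H))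
    have hx0 := hx.1
    rw [Real.norm_of_nonneg (by positivity)]
    exact div_le_self hp.le (by linarith)
  · have : IntegrableOn (fun x : ℝ => x ^ (-(2 * H) - 1)) (Ioi 1) :=
      integrableOn_Ioi_rpow_of_lt (by linarith) one_pos
    refine Integrable.mono' this hm.aestronglyMeasurable ?_
    refine (ae_restrict_iff' measurableSet_Ioi).2 (.of_forall fun x hx => ?_)
    have hx0 : (0 : ℝ) < x := lt_trans one_pos hx
    have hp := Real.rpow_pos_of_pos hx0 (-(2 * H))
    rw [Real.norm_of_nonneg (by positivity), Real.rpow_sub_one hx0.ne']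
    gcongr
    linarith

/-- The value of the integral of the squared Fourier transform of `limitKernel H`. -/
lemma sq_integral_constant {H : ℝ} (hH : H ∈ Ioo (0 : ℝ) (1 / 2)) :
    8 / π * (Real.Gamma (1 - 2 * H))⁻¹ ^ 2 * (π / (2 * Real.cos (π * H))) ^ 2 *
      (2 * ∫ x in Ioi (0 : ℝ), x ^ (2 - 4 * H) / (1 + x ^ 2) ^ 2) =
    2 * (Real.Gamma (2 * H) ^ 2 * sigmaH2 H) := by
  obtain ⟨h0, h1⟩ := hH
  have h := integral_rpow_mul_one_add_sq_rpow (c := 2 - 4 * H) (s := 2) (by linarith) (by linarith)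
  have e : ∀ x : ℝ, x ^ (2 - 4 * H) * (1 + x ^ 2) ^ (-(2 : ℝ)) =
      x ^ (2 - 4 * H) / (1 + x ^ 2) ^ 2 := by
    intro x
    rw [Real.rpow_neg (by positivity), Real.rpow_two, div_eq_mul_inv]
  simp only [e] at h
  rw [h, Real.Gamma_two]
  have hG2 : 0 < Real.Gamma (1 - 2 * H) := Real.Gamma_pos_of_pos (by linarith)
  have hsin : 0 < Real.sin (π * H) :=
    Real.sin_pos_of_pos_of_lt_pi (by positivity) (by nlinarith [Real.pi_pos])
  have hcos : 0 < Real.cos (π * H) :=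
    Real.cos_pos_of_mem_Ioo ⟨by nlinarith [Real.pi_pos], by nlinarith [Real.pi_pos]⟩
  have hrefl := Real.Gamma_mul_Gamma_one_sub (2 * H)
  rw [show π * (2 * H) = 2 * (π * H) by ring, Real.sin_two_mul] at hrefl
  have hG1 : Real.Gamma (2 * H) =
      π / (2 * Real.sin (π * H) * Real.cos (π * H)) * (Real.Gamma (1 - 2 * H))⁻¹ := by
    rw [← hrefl]; field_simp
  have hsc := Real.sin_sq_add_cos_sq (π * H)
  rw [hG1]
  unfold sigmaH2
  split_ifs with hq
  · subst hq
    have : Real.cos (π * (1 / 4)) ^ 2 = 1 / 2 := by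
      rw [show π * (1 / 4) = π / 4 by ring, Real.cos_pi_div_four, div_pow,
        Real.sq_sqrt (by norm_num)]; norm_num
    have h2 : Real.sin (π * (1 / 4)) ^ 2 = 1 / 2 := by linarith
    norm_num
    rw [show π * (1 / 4) = π / 4 by ring] at h2
    field_simp
    rw [h2]; norm_num
  · have hne : Real.cos (2 * (π * H)) ≠ 0 := by
      intro h
      rw [Real.cos_eq_zero_iff] at h
      obtain ⟨k, hk⟩ := h
      have hk' : 4 * H = 2 * k + 1 := by
        have := Real.pi_pos
        field_simp at hk
        linarith
      have hk1 : (k : ℝ) < 1 := by linarith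
      have hk2 : (-1 : ℝ) < k := by linarith
      have : k = 0 := by
        have a : k < 1 := by exact_mod_cast hk1
        have b : -1 < k := by exact_mod_cast hk2
        omega
      subst this
      apply hq; push_cast at hk'; linarith
    have hr := Real.Gamma_mul_Gamma_one_sub (1 / 2 - 2 * H)
    rw [show π * (1 / 2 - 2 * H) = π / 2 - 2 * (π * H) by ring, Real.sin_pi_div_two_sub] at hr
    have hadd := Real.Gamma_add_one (s := 1 / 2 - 2 * H) (by intro h; apply hq; linarith)
    rw [show (2 - 4 * H + 1) / 2 = 1 / 2 - 2 * H + 1 by ring,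
      show 2 - (1 / 2 - 2 * H + 1) = 1 - (1 / 2 - 2 * H) by ring, hadd, mul_assoc (_ - _), hr,
      show 2 * H * π = 2 * (π * H) by ring]
    have hc2 : Real.cos (2 * (π * H)) = 1 - 2 * Real.sin (π * H) ^ 2 := by
      rw [Real.cos_two_mul]; linarith
    have : 1 - 1 / Real.cos (2 * (π * H)) =
        - 2 * Real.sin (π * H) ^ 2 / Real.cos (2 * (π * H)) := by
      rw [eq_div_iff hne, sub_mul, one_mul, div_mul_cancel₀ _ hne, hc2]; ring
    rw [this]
    clear this hc2 hr
    generalize Real.cos (2 * (π * H)) = C at hne ⊢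
    field_simp
    ring

/-- The convolution of the odd extensions of `exp (-x)` and `exp (-l * x)`. -/
noncomputable def expConv (l x : ℝ) : ℝ :=
  2 * (Real.exp (-|x|) - l * Real.exp (-(l * |x|))) / (1 - l ^ 2)

lemma abs_exp_sub_le_of_le_one {l x : ℝ} (hl : 0 ≤ l) (hl1 : l ≤ 1) (hx : 0 ≤ x) :
    |Real.exp (-x) - l * Real.exp (-(l * x))| ≤
      (1 - l) * Real.exp (-x) + l * (Real.exp (-(l * x)) - Real.exp (-x)) := by
  have h : Real.exp (-x) ≤ Real.exp (-(l * x)) := Real.exp_le_exp.2 (by nlinarith)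
  have h0 := Real.exp_pos (-x)
  rw [abs_le]
  constructor <;> nlinarith

lemma abs_exp_sub_le_of_one_le {l x : ℝ} (hl1 : 1 ≤ l) (hx : 0 ≤ x) :
    |Real.exp (-x) - l * Real.exp (-(l * x))| ≤
      (l - 1) * Real.exp (-(l * x)) + (Real.exp (-x) - Real.exp (-(l * x))) := by
  have h : Real.exp (-(l * x)) ≤ Real.exp (-x) := Real.exp_le_exp.2 (by nlinarith)
  have h0 := Real.exp_pos (-(l * x))
  rw [abs_le]
  constructor <;> nlinarith

lemma exp_sub_exp_le {a b : ℝ} : Real.exp (-a) - Real.exp (-b) ≤ (b - a) * Real.exp (-a) := by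
  have h := Real.add_one_le_exp (a - b)
  have : Real.exp (-b) = Real.exp (-a) * Real.exp (a - b) := by rw [← Real.exp_add]; ring_nf
  rw [this]
  nlinarith [Real.exp_pos (-a)]

lemma mul_exp_neg_le_one (y : ℝ) : y * Real.exp (-y) ≤ 1 := by
  have h := Real.add_one_le_exp y
  rw [Real.exp_neg, ← div_eq_mul_inv, div_le_one (Real.exp_pos y)]
  linarith

lemma sq_mul_exp_neg_le_two {y : ℝ} (hy : 0 ≤ y) : y ^ 2 * Real.exp (-y) ≤ 2 := by
  have h := Real.quadratic_le_exp_of_nonneg hy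
  rw [Real.exp_neg, ← div_eq_mul_inv, div_le_iff₀ (Real.exp_pos y)]
  linarith

lemma abs_exp_sub_le {l x : ℝ} (hl : 0 < l) (hx : 0 ≤ x) :
    |Real.exp (-x) - l * Real.exp (-(l * x))| ≤ 2 * |1 - l| := by
  rcases le_total l 1 with h | h
  · refine (abs_exp_sub_le_of_le_one hl.le h hx).trans ?_
    rw [abs_of_nonneg (by linarith)]
    have h1 := exp_sub_exp_le (a := l * x) (b := x)
    have h2 := mul_exp_neg_le_one (l * x)
    have h3 : Real.exp (-x) ≤ 1 := Real.exp_le_one_iff.2 (by linarith)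
    nlinarith
  · refine (abs_exp_sub_le_of_one_le h hx).trans ?_
    rw [abs_of_nonpos (by linarith)]
    have h1 := exp_sub_exp_le (a := x) (b := l * x)
    have h2 := mul_exp_neg_le_one x
    have h3 : Real.exp (-(l * x)) ≤ 1 := Real.exp_le_one_iff.2 (by nlinarith)
    nlinarith

lemma mul_abs_exp_sub_le {l x : ℝ} (hl : 0 < l) (hx : 0 ≤ x) :
    x * |Real.exp (-x) - l * Real.exp (-(l * x))| ≤ 5 * |1 - l| := by
  rcases le_total l 1 with h | h
  · refine (mul_le_mul_of_nonneg_left (abs_exp_sub_le_of_le_one hl.le h hx) hx).trans ?_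
    rw [abs_of_nonneg (by linarith)]
    have h1 := exp_sub_exp_le (a := l * x) (b := x)
    have h2 := mul_exp_neg_le_one (l * x)
    have h3 := mul_exp_neg_le_one x
    have h4 := sq_mul_exp_neg_le_two (y := l * x) (by positivity)
    have h5 := Real.exp_pos (-x)
    have key : l * x * (Real.exp (-(l * x)) - Real.exp (-x)) ≤ 4 * (1 - l) := by
      rcases le_total l (1 / 2) with h' | h'
      · have : 0 ≤ l * x * Real.exp (-x) := by positivity
        nlinarith
      · have h6 : l * x * (Real.exp (-(l * x)) - Real.exp (-x)) ≤
            l * x * ((x - l * x) * Real.exp (-(l * x))) := by gcongr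
        have h7 : l * (l * x * ((x - l * x) * Real.exp (-(l * x)))) ≤ 2 * (1 - l) := by
          nlinarith
        nlinarith
    nlinarith
  · refine (mul_le_mul_of_nonneg_left (abs_exp_sub_le_of_one_le h hx) hx).trans ?_
    rw [abs_of_nonpos (by linarith)]
    have h1 := exp_sub_exp_le (a := x) (b := l * x)
    have h2 := mul_exp_neg_le_one (l * x)
    have h3 := sq_mul_exp_neg_le_two hx
    have h4 : x * (Real.exp (-x) - Real.exp (-(l * x))) ≤ x * ((l * x - x) * Real.exp (-x)) := by
      gcongr
    have h5 : x * Real.exp (-(l * x)) ≤ 1 := by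
      have := Real.exp_pos (-(l * x))
      nlinarith [mul_nonneg hx this.le]
    nlinarith

lemma abs_expConv_eq {l : ℝ} (hl : 0 < l) (x : ℝ) :
    |expConv l x| = 2 * |Real.exp (-|x|) - l * Real.exp (-(l * |x|))| / (|1 - l| * (1 + l)) := by
  rw [expConv, abs_div, abs_mul, abs_two, show 1 - l ^ 2 = (1 - l) * (1 + l) by ring, abs_mul,
    abs_of_pos (show 0 < 1 + l by linarith)]

lemma abs_expConv_le {l : ℝ} (hl : 0 < l) (x : ℝ) : |expConv l x| ≤ 4 / (1 + l) := by
  rw [abs_expConv_eq hl]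
  rcases eq_or_ne l 1 with rfl | h
  · norm_num
  have h1 : 0 < |1 - l| := abs_pos.2 (sub_ne_zero.2 h.symm)
  have := abs_exp_sub_le hl (abs_nonneg x)
  rw [div_le_div_iff₀ (by positivity) (by positivity)]
  nlinarith

lemma abs_mul_abs_expConv_le {l : ℝ} (hl : 0 < l) (x : ℝ) :
    |x| * |expConv l x| ≤ 10 / (1 + l) := by
  rw [abs_expConv_eq hl]
  rcases eq_or_ne l 1 with rfl | h
  · norm_num
  have h1 : 0 < |1 - l| := abs_pos.2 (sub_ne_zero.2 h.symm)
  have := mul_abs_exp_sub_le hl (abs_nonneg x)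
  rw [← mul_div_assoc, div_le_div_iff₀ (by positivity) (by positivity)]
  have h2 : 0 < 1 + l := by linarith
  calc _ = 2 * (|x| * |Real.exp (-|x|) - l * Real.exp (-(l * |x|))|) * (1 + l) := by ring
    _ ≤ 2 * (5 * |1 - l|) * (1 + l) := by gcongr
    _ = _ := by ring

lemma integral_exp_neg_mul_abs {l : ℝ} (hl : 0 < l) :
    ∫ x : ℝ, Real.exp (-(l * |x|)) = 2 / l := by
  rw [integral_comp_abs (f := fun x => Real.exp (-(l * x)))]
  have := integral_exp_mul_Ioi (neg_lt_zero.2 hl) 0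
  simp only [neg_mul] at this
  rw [this]
  simp
  ring

lemma integrable_exp_neg_mul_abs {l : ℝ} (hl : 0 < l) :
    Integrable (fun x : ℝ => Real.exp (-(l * |x|))) :=
  Integrable.of_integral_ne_zero (by rw [integral_exp_neg_mul_abs hl]; positivity)

lemma measurable_expConv : Measurable (Function.uncurry expConv) := by
  unfold expConv Function.uncurry
  fun_prop

lemma integrable_expConv {l : ℝ} (hl : 0 < l) : Integrable (expConv l) := by
  have h1 := integrable_exp_neg_mul_abs one_pos
  simp only [one_mul] at h1
  exact ((h1.sub ((integrable_exp_neg_mul_abs hl).const_mul l)).const_mul 2).div_const _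

lemma integral_abs_expConv_le {l : ℝ} (hl : 0 < l) : ∫ x, |expConv l x| ≤ 8 / (1 + l) := by
  have i1 := integrable_exp_neg_mul_abs one_pos
  have v1 := integral_exp_neg_mul_abs one_pos
  simp only [one_mul] at i1 v1
  have i2 := integrable_exp_neg_mul_abs hl
  have v2 := integral_exp_neg_mul_abs hl
  rcases eq_or_ne l 1 with rfl | h
  · simp [expConv]
    norm_num
  have h1 : 0 < |1 - l| := abs_pos.2 (sub_ne_zero.2 h.symm)
  have key : ∫ x : ℝ, |Real.exp (-|x|) - l * Real.exp (-(l * |x|))| ≤ 4 * |1 - l| := by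
    have i0 : Integrable fun x : ℝ => |Real.exp (-|x|) - l * Real.exp (-(l * |x|))| :=
      (i1.sub (i2.const_mul l)).abs
    rcases le_total l 1 with h' | h'
    · calc _ ≤ ∫ x : ℝ, ((1 - l) * Real.exp (-|x|) +
              l * (Real.exp (-(l * |x|)) - Real.exp (-|x|))) :=
            integral_mono i0 ((i1.const_mul _).add ((i2.sub i1).const_mul _))
              fun x => abs_exp_sub_le_of_le_one hl.le h' (abs_nonneg x)
        _ = (1 - l) * 2 + l * (2 / l - 2) := by
            have i3 : Integrable fun x : ℝ => Real.exp (-(l * |x|)) - Real.exp (-|x|) := i2.sub i1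
            rw [MeasureTheory.integral_add (i1.const_mul _) (i3.const_mul _),
              MeasureTheory.integral_const_mul, MeasureTheory.integral_const_mul,
              MeasureTheory.integral_sub i2 i1, v1, v2]
            norm_num
        _ ≤ _ := by
            rw [abs_of_nonneg (by linarith)]
            field_simp
            linarith
    · calc _ ≤ ∫ x : ℝ, ((l - 1) * Real.exp (-(l * |x|)) +
              (Real.exp (-|x|) - Real.exp (-(l * |x|)))) :=
            integral_mono i0 ((i2.const_mul _).add (i1.sub i2))
              fun x => abs_exp_sub_le_of_one_le h' (abs_nonneg x)
        _ = (l - 1) * (2 / l) + (2 - 2 / l) := by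
            have i3 : Integrable fun x : ℝ => Real.exp (-|x|) - Real.exp (-(l * |x|)) := i1.sub i2
            rw [MeasureTheory.integral_add (i2.const_mul _) i3,
              MeasureTheory.integral_const_mul, MeasureTheory.integral_sub i1 i2, v1, v2]
            norm_num
        _ ≤ _ := by
            rw [abs_of_nonpos (by linarith)]
            field_simp
            nlinarith
  simp only [abs_expConv_eq hl]
  rw [MeasureTheory.integral_div, MeasureTheory.integral_const_mul,
    div_le_div_iff₀ (by positivity) (by positivity)]
  nlinarith

lemma expConv_neg (l x : ℝ) : expConv l (-x) = expConv l x := by simp [expConv]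

/-- The full-line convolution of the odd exponential with the odd power `2 * H - 1`, as a
superposition of exponentials. -/
noncomputable def limitKernel (H x : ℝ) : ℝ :=
  (Real.Gamma (1 - 2 * H))⁻¹ * ∫ l in Ioi (0 : ℝ), l ^ (-(2 * H)) * expConv l x

lemma limitKernel_neg (H x : ℝ) : limitKernel H (-x) = limitKernel H x := by
  simp only [limitKernel, expConv_neg]

lemma norm_rpow_mul_expConv_le {H l : ℝ} (hl : 0 < l) (x : ℝ) :
    ‖l ^ (-(2 * H)) * expConv l x‖ ≤ 4 * (l ^ (-(2 * H)) / (1 + l)) := by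
  rw [norm_mul, Real.norm_of_nonneg (Real.rpow_nonneg hl.le _), Real.norm_eq_abs]
  have := abs_expConv_le hl x
  have hp := Real.rpow_nonneg hl.le (-(2 * H))
  calc _ ≤ l ^ (-(2 * H)) * (4 / (1 + l)) := by gcongr
    _ = _ := by ring

lemma integrableOn_rpow_mul_expConv {H : ℝ} (hH : H ∈ Ioo (0 : ℝ) (1 / 2)) (x : ℝ) :
    IntegrableOn (fun l => l ^ (-(2 * H)) * expConv l x) (Ioi 0) := by
  refine Integrable.mono' ((integrableOn_rpow_div_one_add hH).const_mul 4) ?_ ?_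
  · have hx : Measurable fun l => expConv l x :=
      measurable_expConv.comp (measurable_id.prodMk measurable_const)
    exact ((measurable_id.pow_const (-(2 * H))).mul hx).aestronglyMeasurable
  · exact (ae_restrict_iff' measurableSet_Ioi).2
      (.of_forall fun l hl => norm_rpow_mul_expConv_le hl x)

lemma continuous_limitKernel {H : ℝ} (hH : H ∈ Ioo (0 : ℝ) (1 / 2)) :
    Continuous (limitKernel H) := by
  refine Continuous.mul continuous_const ?_
  refine continuous_of_dominated (bound := fun l => 4 * (l ^ (-(2 * H)) / (1 + l)))
    (fun x => (integrableOn_rpow_mul_expConv hH x).aestronglyMeasurable) (fun x => ?_)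
    ((integrableOn_rpow_div_one_add hH).const_mul 4) (.of_forall fun l => ?_)
  · exact (ae_restrict_iff' measurableSet_Ioi).2
      (.of_forall fun l hl => norm_rpow_mul_expConv_le hl x)
  · unfold expConv
    fun_prop

lemma exists_abs_limitKernel_le {H : ℝ} (hH : H ∈ Ioo (0 : ℝ) (1 / 2)) :
    ∃ C, ∀ x, |limitKernel H x| ≤ C ∧ |x| * |limitKernel H x| ≤ C := by
  obtain ⟨h0, h1⟩ := hH
  have hG : 0 < (Real.Gamma (1 - 2 * H))⁻¹ := inv_pos.2 (Real.Gamma_pos_of_pos (by linarith))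
  set N := ∫ l in Ioi (0 : ℝ), l ^ (-(2 * H)) / (1 + l) with hN
  have hNI := integrableOn_rpow_div_one_add ⟨h0, h1⟩
  have hN0 : 0 ≤ N := setIntegral_nonneg measurableSet_Ioi fun l hl => by
    have hl : (0 : ℝ) < l := hl
    positivity
  refine ⟨(Real.Gamma (1 - 2 * H))⁻¹ * (10 * N), fun x => ⟨?_, ?_⟩⟩
  · rw [limitKernel, abs_mul, abs_of_pos hG]
    refine mul_le_mul_of_nonneg_left ?_ hG.le
    calc _ ≤ ∫ l in Ioi (0 : ℝ), 4 * (l ^ (-(2 * H)) / (1 + l)) :=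
          norm_integral_le_of_norm_le (hNI.const_mul 4)
            ((ae_restrict_iff' measurableSet_Ioi).2
              (.of_forall fun l hl => norm_rpow_mul_expConv_le hl x))
      _ = 4 * N := MeasureTheory.integral_const_mul _ _
      _ ≤ 10 * N := by linarith
  · rw [limitKernel, abs_mul, abs_of_pos hG, mul_left_comm]
    refine mul_le_mul_of_nonneg_left ?_ hG.le
    calc _ = |∫ l in Ioi (0 : ℝ), x * (l ^ (-(2 * H)) * expConv l x)| := by
          rw [MeasureTheory.integral_const_mul, abs_mul]
      _ ≤ ∫ l in Ioi (0 : ℝ), 10 * (l ^ (-(2 * H)) / (1 + l)) := by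
          rw [← Real.norm_eq_abs]
          refine norm_integral_le_of_norm_le (hNI.const_mul 10)
            ((ae_restrict_iff' measurableSet_Ioi).2 (.of_forall fun l hl => ?_))
          have hl : (0 : ℝ) < l := hl
          rw [norm_mul, norm_mul, Real.norm_of_nonneg (Real.rpow_nonneg hl.le _),
            Real.norm_eq_abs, Real.norm_eq_abs, mul_left_comm]
          have := abs_mul_abs_expConv_le hl x
          calc _ ≤ l ^ (-(2 * H)) * (10 / (1 + l)) := by gcongr
            _ = _ := by ring
      _ = 10 * N := MeasureTheory.integral_const_mul _ _

lemma integrable_rpow_mul_expConv_prod {H : ℝ} (hH : H ∈ Ioo (0 : ℝ) (1 / 2)) :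
    Integrable (fun z : ℝ × ℝ => z.2 ^ (-(2 * H)) * expConv z.2 z.1)
      (volume.prod (volume.restrict (Ioi (0 : ℝ)))) := by
  have hm : Measurable (fun z : ℝ × ℝ => z.2 ^ (-(2 * H)) * expConv z.2 z.1) := by
    have : Measurable fun z : ℝ × ℝ => expConv z.2 z.1 :=
      measurable_expConv.comp (measurable_snd.prodMk measurable_fst)
    fun_prop
  rw [integrable_prod_iff' hm.aestronglyMeasurable]
  constructor
  · exact (ae_restrict_iff' measurableSet_Ioi).2
      (.of_forall fun l hl => (integrable_expConv hl).const_mul (l ^ (-(2 * H))))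
  · refine Integrable.mono' ((integrableOn_rpow_div_one_add hH).const_mul 8)
      hm.aestronglyMeasurable.norm.prod_swap.integral_prod_right'
      ((ae_restrict_iff' measurableSet_Ioi).2 (.of_forall fun l hl => ?_))
    have hl : (0 : ℝ) < l := hl
    rw [Real.norm_of_nonneg (by positivity)]
    simp only [norm_mul]
    rw [MeasureTheory.integral_const_mul, Real.norm_of_nonneg (Real.rpow_nonneg hl.le _)]
    have := integral_abs_expConv_le hl
    simp only [Real.norm_eq_abs]
    calc _ ≤ l ^ (-(2 * H)) * (8 / (1 + l)) := by gcongr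
      _ = _ := by ring

lemma integrable_limitKernel {H : ℝ} (hH : H ∈ Ioo (0 : ℝ) (1 / 2)) :
    Integrable (limitKernel H) :=
  (integrable_rpow_mul_expConv_prod hH).integral_prod_left.const_mul _

open scoped FourierTransform

lemma integral_cexp_mul_exp_neg_mul_abs {l : ℝ} (hl : 0 < l) (ξ : ℝ) :
    ∫ x : ℝ, Complex.exp (((-(ξ * x) : ℝ) : ℂ) * Complex.I) * (Real.exp (-(l * |x|)) : ℂ) =
      ((2 * l / (l ^ 2 + ξ ^ 2) : ℝ) : ℂ) := by
  have hint : Integrable fun x : ℝ =>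
      Complex.exp (((-(ξ * x) : ℝ) : ℂ) * Complex.I) * (Real.exp (-(l * |x|)) : ℂ) := by
    refine (integrable_exp_neg_mul_abs hl).ofReal.bdd_mul (c := 1)
      (Continuous.aestronglyMeasurable (by fun_prop)) (.of_forall fun x => ?_)
    rw [Complex.norm_exp_ofReal_mul_I]
  have e1 : ∀ x ∈ Iic (0 : ℝ),
      Complex.exp (((-(ξ * x) : ℝ) : ℂ) * Complex.I) * (Real.exp (-(l * |x|)) : ℂ) =
        Complex.exp ((l - ξ * Complex.I) * x) := by
    intro x hx
    rw [abs_of_nonpos hx, Complex.ofReal_exp, ← Complex.exp_add]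
    congr 1; push_cast; ring
  have e2 : ∀ x ∈ Ioi (0 : ℝ),
      Complex.exp (((-(ξ * x) : ℝ) : ℂ) * Complex.I) * (Real.exp (-(l * |x|)) : ℂ) =
        Complex.exp ((-l - ξ * Complex.I) * x) := by
    intro x hx
    rw [abs_of_pos hx, Complex.ofReal_exp, ← Complex.exp_add]
    congr 1; push_cast; ring
  rw [← intervalIntegral.integral_Iic_add_Ioi hint.integrableOn hint.integrableOn,
    setIntegral_congr_fun measurableSet_Iic e1, setIntegral_congr_fun measurableSet_Ioi e2,
    integral_exp_mul_complex_Iic (by simpa using hl),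
    integral_exp_mul_complex_Ioi (by simpa using hl)]
  have h1 : (l : ℂ) - ξ * Complex.I ≠ 0 := by
    intro h; have := congrArg Complex.re h; simp at this; exact hl.ne' this
  have h2 : -(l : ℂ) - ξ * Complex.I ≠ 0 := by
    intro h; have := congrArg Complex.re h; simp at this; exact hl.ne' this
  have h3 : (l : ℂ) ^ 2 + (ξ : ℂ) ^ 2 ≠ 0 := by
    have : (l ^ 2 + ξ ^ 2 : ℝ) ≠ 0 := by positivity
    exact_mod_cast this
  push_cast
  simp only [mul_zero, Complex.exp_zero]
  rw [div_add_div _ _ h1 h2, div_eq_div_iff (mul_ne_zero h1 h2) h3]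
  ring_nf
  rw [Complex.I_sq]
  ring

lemma integral_cexp_mul_expConv {l : ℝ} (hl : 0 < l) (hl1 : l ≠ 1) (ξ : ℝ) :
    ∫ x : ℝ, Complex.exp (((-(ξ * x) : ℝ) : ℂ) * Complex.I) * (expConv l x : ℂ) =
      ((4 * ξ ^ 2 / ((1 + ξ ^ 2) * (l ^ 2 + ξ ^ 2)) : ℝ) : ℂ) := by
  have hint : ∀ {m : ℝ}, 0 < m → Integrable fun x : ℝ =>
      Complex.exp (((-(ξ * x) : ℝ) : ℂ) * Complex.I) * (Real.exp (-(m * |x|)) : ℂ) := by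
    intro m hm
    refine (integrable_exp_neg_mul_abs hm).ofReal.bdd_mul (c := 1)
      (Continuous.aestronglyMeasurable (by fun_prop)) (.of_forall fun x => ?_)
    rw [Complex.norm_exp_ofReal_mul_I]
  have h1 : (1 : ℝ) - l ^ 2 ≠ 0 := by
    rw [show (1 : ℝ) - l ^ 2 = (1 - l) * (1 + l) by ring]
    exact mul_ne_zero (sub_ne_zero.2 hl1.symm) (by positivity)
  have e : ∀ x : ℝ, Complex.exp (((-(ξ * x) : ℝ) : ℂ) * Complex.I) * (expConv l x : ℂ) =
      ((2 / (1 - l ^ 2) : ℝ) : ℂ) *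
        (Complex.exp (((-(ξ * x) : ℝ) : ℂ) * Complex.I) * (Real.exp (-(1 * |x|)) : ℂ)) -
      ((2 * l / (1 - l ^ 2) : ℝ) : ℂ) *
        (Complex.exp (((-(ξ * x) : ℝ) : ℂ) * Complex.I) * (Real.exp (-(l * |x|)) : ℂ)) := by
    intro x
    simp only [expConv, one_mul]
    push_cast
    ring
  simp only [e]
  rw [MeasureTheory.integral_sub ((hint one_pos).const_mul _) ((hint hl).const_mul _),
    MeasureTheory.integral_const_mul, MeasureTheory.integral_const_mul,
    integral_cexp_mul_exp_neg_mul_abs one_pos, integral_cexp_mul_exp_neg_mul_abs hl,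
    ← Complex.ofReal_mul, ← Complex.ofReal_mul, ← Complex.ofReal_sub]
  congr 1
  field_simp
  ring

lemma integral_rpow_div_sq_add_sq {H ξ : ℝ} (hH : H ∈ Ioo (0 : ℝ) (1 / 2)) (hξ : ξ ≠ 0) :
    ∫ l in Ioi (0 : ℝ), l ^ (-(2 * H)) * (4 * ξ ^ 2 / ((1 + ξ ^ 2) * (l ^ 2 + ξ ^ 2))) =
      4 * (π / (2 * Real.cos (π * H))) * (|ξ| ^ (1 - 2 * H) / (1 + ξ ^ 2)) := by
  have hx : 0 < |ξ| := abs_pos.2 hξ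
  have h := integral_comp_mul_left_Ioi
    (fun l => l ^ (-(2 * H)) * (4 * ξ ^ 2 / ((1 + ξ ^ 2) * (l ^ 2 + ξ ^ 2)))) 0 hx
  rw [mul_zero, smul_eq_mul, eq_comm, inv_mul_eq_iff_eq_mul₀ hx.ne'] at h
  rw [h, ← integral_rpow_div_one_add_sq hH]
  have e : ∀ l ∈ Ioi (0 : ℝ), (|ξ| * l) ^ (-(2 * H)) *
      (4 * ξ ^ 2 / ((1 + ξ ^ 2) * ((|ξ| * l) ^ 2 + ξ ^ 2))) =
      (4 * |ξ| ^ (-(2 * H)) / (1 + ξ ^ 2)) * (l ^ (-(2 * H)) / (1 + l ^ 2)) := by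
    intro l hl
    have hl : (0 : ℝ) < l := hl
    rw [Real.mul_rpow hx.le hl.le, mul_pow, sq_abs]
    field_simp
    ring
  rw [setIntegral_congr_fun measurableSet_Ioi e, MeasureTheory.integral_const_mul,
    show 1 - 2 * H = -(2 * H) + 1 by ring, Real.rpow_add_one hx.ne']
  ring

lemma fourier_limitKernel {H : ℝ} (hH : H ∈ Ioo (0 : ℝ) (1 / 2)) (w : ℝ) :
    𝓕 (fun x => (limitKernel H x : ℂ)) w =
      ((4 * (Real.Gamma (1 - 2 * H))⁻¹ * (π / (2 * Real.cos (π * H))) *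
        (|2 * π * w| ^ (1 - 2 * H) / (1 + (2 * π * w) ^ 2)) : ℝ) : ℂ) := by
  set ξ := 2 * π * w with hξ
  have hint : Integrable (fun z : ℝ × ℝ => Complex.exp (((-(ξ * z.1) : ℝ) : ℂ) * Complex.I) *
      ((z.2 ^ (-(2 * H)) * expConv z.2 z.1 : ℝ) : ℂ))
      (volume.prod (volume.restrict (Ioi (0 : ℝ)))) := by
    refine (integrable_rpow_mul_expConv_prod hH).ofReal.bdd_mul (c := 1)
      (Continuous.aestronglyMeasurable (by fun_prop)) (.of_forall fun x => ?_)
    rw [Complex.norm_exp_ofReal_mul_I]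
  have hswap := integral_integral_swap (f := fun x l : ℝ =>
    Complex.exp (((-(ξ * x) : ℝ) : ℂ) * Complex.I) *
      ((l ^ (-(2 * H)) * expConv l x : ℝ) : ℂ)) hint
  have hl : ∀ x : ℝ, ∫ l in Ioi (0 : ℝ), Complex.exp (((-(ξ * x) : ℝ) : ℂ) * Complex.I) *
      ((l ^ (-(2 * H)) * expConv l x : ℝ) : ℂ) =
      Complex.exp (((-(ξ * x) : ℝ) : ℂ) * Complex.I) *
        ((∫ l in Ioi (0 : ℝ), l ^ (-(2 * H)) * expConv l x : ℝ) : ℂ) := by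
    intro x
    rw [MeasureTheory.integral_const_mul, integral_complex_ofReal]
  have hr : ∫ l in Ioi (0 : ℝ), ∫ x : ℝ, Complex.exp (((-(ξ * x) : ℝ) : ℂ) * Complex.I) *
      ((l ^ (-(2 * H)) * expConv l x : ℝ) : ℂ) =
      ((∫ l in Ioi (0 : ℝ),
        l ^ (-(2 * H)) * (4 * ξ ^ 2 / ((1 + ξ ^ 2) * (l ^ 2 + ξ ^ 2))) : ℝ) : ℂ) := by
    rw [← integral_complex_ofReal]
    refine integral_congr_ae ?_
    filter_upwards [ae_restrict_mem measurableSet_Ioi,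
      ae_restrict_of_ae (Measure.ae_ne volume (1 : ℝ))] with l hl hl1
    rw [Complex.ofReal_mul, ← integral_cexp_mul_expConv hl hl1, ← MeasureTheory.integral_const_mul]
    refine integral_congr_ae (.of_forall fun x => ?_)
    simp only [Complex.ofReal_mul]
    ring
  rw [Real.fourier_real_eq_integral_exp_smul]
  have e : ∀ x : ℝ, Complex.exp (((-2 * π * x * w : ℝ) : ℂ) * Complex.I) •
      (limitKernel H x : ℂ) = (((Real.Gamma (1 - 2 * H))⁻¹ : ℝ) : ℂ) *
      (Complex.exp (((-(ξ * x) : ℝ) : ℂ) * Complex.I) *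
        ((∫ l in Ioi (0 : ℝ), l ^ (-(2 * H)) * expConv l x : ℝ) : ℂ)) := by
    intro x
    rw [show -2 * π * x * w = -(ξ * x) by rw [hξ]; ring, smul_eq_mul, limitKernel,
      Complex.ofReal_mul]
    ring
  simp only [e]
  rw [MeasureTheory.integral_const_mul, ← funext hl, hswap, hr, ← Complex.ofReal_mul]
  congr 1
  rcases eq_or_ne ξ 0 with h0 | h0
  · rw [h0]
    have : 1 - 2 * H ≠ 0 := by linarith [hH.2]
    simp [Real.zero_rpow this]
  · rw [integral_rpow_div_sq_add_sq hH h0]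
    ring

/-- Parseval's identity for even functions with an integrable transform. -/
lemma integral_sq_eq_of_fourier_eq {f g : ℝ → ℝ} (hf : Continuous f) (hfi : Integrable f)
    (heven : ∀ x, f (-x) = f x) (hgi : Integrable g)
    (hfg : ∀ w, 𝓕 (fun x => (f x : ℂ)) w = (g w : ℂ)) :
    ∫ x, f x ^ 2 = ∫ w, g w ^ 2 := by
  have hfg' : 𝓕 (fun x => (f x : ℂ)) = fun w => (g w : ℂ) := funext hfg
  have hg : 𝓕 (fun w => (g w : ℂ)) = fun x => (f x : ℂ) := by
    have h := Continuous.fourierInv_fourier_eq (f := fun x => (f x : ℂ))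
      (Complex.continuous_ofReal.comp hf) hfi.ofReal (by rw [hfg']; exact hgi.ofReal)
    rw [hfg'] at h
    ext x
    have hx := congrFun h (-x)
    rw [Real.fourierInv_eq_fourier_neg, neg_neg] at hx
    rw [hx, heven]
  have h := VectorFourier.integral_fourierIntegral_smul_eq_flip (L := innerₗ ℝ)
      (f := fun x => (f x : ℂ)) (g := fun x => (g x : ℂ)) (μ := volume) (ν := volume)
      Real.continuous_fourierChar continuous_inner hfi.ofReal hgi.ofReal
  have h' : ∫ ξ, 𝓕 (fun x => (f x : ℂ)) ξ • (g ξ : ℂ) =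
      ∫ x, (f x : ℂ) • 𝓕 (fun w => (g w : ℂ)) x := by
    simpa using! h
  rw [hfg', hg] at h'
  have h2 : ((∫ x, f x ^ 2 : ℝ) : ℂ) = ((∫ w, g w ^ 2 : ℝ) : ℂ) := by
    rw [← integral_complex_ofReal, ← integral_complex_ofReal]
    simpa [sq] using h'.symm
  exact_mod_cast h2

lemma integrable_abs_rpow_div_one_add_sq {H : ℝ} (hH : H ∈ Ioo (0 : ℝ) (1 / 2)) :
    Integrable fun ξ : ℝ => |ξ| ^ (1 - 2 * H) / (1 + ξ ^ 2) := by
  obtain ⟨h0, h1⟩ := hH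
  refine Integrable.of_integral_ne_zero ?_
  have h := integral_comp_abs (f := fun ξ : ℝ => ξ ^ (1 - 2 * H) * (1 + ξ ^ 2) ^ (-(1 : ℝ)))
  rw [integral_rpow_mul_one_add_sq_rpow (by linarith) (by linarith)] at h
  simp only [sq_abs, Real.rpow_neg_one, ← div_eq_mul_inv] at h
  rw [h]
  have h2 : 0 < Real.Gamma ((1 - 2 * H + 1) / 2) := Real.Gamma_pos_of_pos (by linarith)
  have h3 : 0 < Real.Gamma (1 - (1 - 2 * H + 1) / 2) := Real.Gamma_pos_of_pos (by linarith)
  rw [Real.Gamma_one]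
  positivity

lemma integral_limitKernel_sq {H : ℝ} (hH : H ∈ Ioo (0 : ℝ) (1 / 2)) :
    ∫ x, limitKernel H x ^ 2 = 2 * (Real.Gamma (2 * H) ^ 2 * sigmaH2 H) := by
  have hpi : (2 * π) ≠ 0 := by positivity
  rw [integral_sq_eq_of_fourier_eq (continuous_limitKernel hH) (integrable_limitKernel hH)
    (limitKernel_neg H)
    (((integrable_abs_rpow_div_one_add_sq hH).comp_mul_left' hpi).const_mul _)
    (fourier_limitKernel hH), ← sq_integral_constant hH]
  have e : ∀ w : ℝ, (4 * (Real.Gamma (1 - 2 * H))⁻¹ * (π / (2 * Real.cos (π * H))) *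
        (|2 * π * w| ^ (1 - 2 * H) / (1 + (2 * π * w) ^ 2))) ^ 2 =
      16 * (Real.Gamma (1 - 2 * H))⁻¹ ^ 2 * (π / (2 * Real.cos (π * H))) ^ 2 *
        (fun x => |x| ^ (2 - 4 * H) / (1 + |x| ^ 2) ^ 2) (2 * π * w) := by
    intro w
    have : |2 * π * w| ^ (2 - 4 * H) = (|2 * π * w| ^ (1 - 2 * H)) ^ 2 := by
      rw [← Real.rpow_mul_natCast (abs_nonneg _)]
      congr 1; push_cast; ring
    dsimp only
    rw [this, sq_abs, mul_pow, div_pow]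
    ring
  rw [funext e, MeasureTheory.integral_const_mul, Measure.integral_comp_mul_left
      (fun x : ℝ => |x| ^ (2 - 4 * H) / (1 + |x| ^ 2) ^ 2),
    integral_comp_abs (f := fun x : ℝ => x ^ (2 - 4 * H) / (1 + x ^ 2) ^ 2),
    abs_of_pos (by positivity), smul_eq_mul]
  field_simp
  ring

/-- The odd extension of `x ^ (2 * H - 1)`. -/
noncomputable def oddRpow (H z : ℝ) : ℝ := Real.sign z * |z| ^ (2 * H - 1)

/-- The odd extension of `exp (-l * x)`. -/
noncomputable def oddExp (l z : ℝ) : ℝ := Real.sign z * Real.exp (-(l * |z|))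

lemma measurable_real_sign : Measurable Real.sign := by
  unfold Real.sign
  exact Measurable.ite measurableSet_Iio measurable_const
    (Measurable.ite measurableSet_Ioi measurable_const measurable_const)

lemma measurable_oddRpow (H : ℝ) : Measurable (oddRpow H) :=
  measurable_real_sign.mul (by fun_prop)

lemma measurable_oddExp : Measurable (Function.uncurry oddExp) :=
  (measurable_real_sign.comp measurable_snd).mul (by fun_prop)

lemma abs_real_sign_le (z : ℝ) : |Real.sign z| ≤ 1 := by
  rcases Real.sign_apply_eq z with h | h | h <;> simp [h]

lemma oddRpow_neg (H z : ℝ) : oddRpow H (-z) = -oddRpow H z := by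
  simp [oddRpow, Real.sign_neg]

lemma oddExp_neg (l z : ℝ) : oddExp l (-z) = -oddExp l z := by
  simp [oddExp, Real.sign_neg]

lemma abs_oddExp_le {l : ℝ} (hl : 0 ≤ l) (z : ℝ) : |oddExp l z| ≤ 1 := by
  rw [oddExp, abs_mul, abs_of_pos (Real.exp_pos _)]
  exact mul_le_one₀ (abs_real_sign_le z) (Real.exp_pos _).le
    (Real.exp_le_one_iff.2 (by have := abs_nonneg z; nlinarith))

/-- The restriction of `|z| ^ (2 * H - 1)` to `|z| ≤ 1`. -/
noncomputable def singularPart (H z : ℝ) : ℝ := (Iic (1 : ℝ)).indicator (· ^ (2 * H - 1)) |z|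

lemma singularPart_nonneg (H z : ℝ) : 0 ≤ singularPart H z :=
  indicator_apply_nonneg fun _ => Real.rpow_nonneg (abs_nonneg z) _

lemma integrable_singularPart {H : ℝ} (hH : H ∈ Ioo (0 : ℝ) (1 / 2)) :
    Integrable (singularPart H) := by
  refine Integrable.of_integral_ne_zero ?_
  unfold singularPart
  rw [integral_comp_abs (f := (Iic (1 : ℝ)).indicator (· ^ (2 * H - 1))),
    setIntegral_indicator measurableSet_Iic, Ioi_inter_Iic,
    ← intervalIntegral.integral_of_le zero_le_one,
    integral_rpow (Or.inl (by linarith [hH.1]))]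
  have h : 2 * H - 1 + 1 ≠ 0 := by linarith [hH.1]
  rw [Real.one_rpow, Real.zero_rpow h]
  have := hH.1
  positivity

lemma abs_rpow_le_one_add {H : ℝ} (hH : H ∈ Ioo (0 : ℝ) (1 / 2)) (z : ℝ) :
    |z| ^ (2 * H - 1) ≤ 1 + singularPart H z := by
  by_cases h : |z| ≤ 1
  · rw [singularPart, indicator_of_mem (mem_Iic.2 h)]
    linarith
  · rw [singularPart, indicator_of_notMem (by simpa using h), add_zero]
    exact Real.rpow_le_one_of_one_le_of_nonpos (not_le.1 h).le (by linarith [hH.2])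

lemma abs_oddRpow_le {H : ℝ} (hH : H ∈ Ioo (0 : ℝ) (1 / 2)) (z : ℝ) :
    |oddRpow H z| ≤ 1 + singularPart H z := by
  rw [oddRpow, abs_mul, abs_of_nonneg (Real.rpow_nonneg (abs_nonneg z) _)]
  have := Real.rpow_nonneg (abs_nonneg z) (2 * H - 1)
  have := abs_real_sign_le z
  have := abs_rpow_le_one_add hH z
  nlinarith

lemma integral_rpow_mul_exp_eq_rpow {H v : ℝ} (hH : H ∈ Ioo (0 : ℝ) (1 / 2)) (hv : 0 < v) :
    ∫ l in Ioi (0 : ℝ), l ^ (-(2 * H)) * Real.exp (-(l * v)) =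
      Real.Gamma (1 - 2 * H) * v ^ (2 * H - 1) := by
  have h := Real.integral_rpow_mul_exp_neg_mul_Ioi (a := 1 - 2 * H) (by linarith [hH.2]) hv
  rw [show 1 - 2 * H - 1 = -(2 * H) by ring, one_div, Real.inv_rpow hv.le,
    ← Real.rpow_neg hv.le, show -(1 - 2 * H) = 2 * H - 1 by ring] at h
  rw [mul_comm (Real.Gamma _), ← h]
  simp only [mul_comm v]

lemma oddRpow_eq_integral {H : ℝ} (hH : H ∈ Ioo (0 : ℝ) (1 / 2)) (z : ℝ) :
    oddRpow H z = (Real.Gamma (1 - 2 * H))⁻¹ *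
      ∫ l in Ioi (0 : ℝ), l ^ (-(2 * H)) * oddExp l z := by
  have hG : 0 < Real.Gamma (1 - 2 * H) := Real.Gamma_pos_of_pos (by linarith [hH.2])
  rcases eq_or_ne z 0 with rfl | hz
  · simp [oddRpow, oddExp]
  · simp only [oddExp, mul_left_comm _ (Real.sign z)]
    rw [MeasureTheory.integral_const_mul, integral_rpow_mul_exp_eq_rpow hH (abs_pos.2 hz), oddRpow]
    field_simp

lemma integrable_rpow_mul_oddExp_prod {H : ℝ} (hH : H ∈ Ioo (0 : ℝ) (1 / 2)) (T s : ℝ) :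
    Integrable (fun z : ℝ × ℝ => z.2 ^ (-(2 * H)) * oddExp z.2 (z.1 - s))
      ((volume.restrict (Ioc 0 T)).prod (volume.restrict (Ioi (0 : ℝ)))) := by
  have hm : Measurable (fun z : ℝ × ℝ => z.2 ^ (-(2 * H)) * oddExp z.2 (z.1 - s)) := by
    have : Measurable fun z : ℝ × ℝ => oddExp z.2 (z.1 - s) :=
      measurable_oddExp.comp (measurable_snd.prodMk (measurable_fst.sub_const s))
    exact (measurable_snd.pow_const _).mul this
  have hG : 0 < Real.Gamma (1 - 2 * H) := Real.Gamma_pos_of_pos (by linarith [hH.2])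
  have hsign : ∀ {z : ℝ}, z ≠ 0 → |Real.sign z| = 1 := by
    intro z hz
    rcases Real.sign_apply_eq_of_ne_zero z hz with h | h <;> simp [h]
  have hv : ∀ {y : ℝ}, y ≠ s → ∫ l in Ioi (0 : ℝ), ‖l ^ (-(2 * H)) * oddExp l (y - s)‖ =
      Real.Gamma (1 - 2 * H) * |y - s| ^ (2 * H - 1) := by
    intro y hy
    rw [← integral_rpow_mul_exp_eq_rpow hH (abs_pos.2 (sub_ne_zero.2 hy))]
    refine setIntegral_congr_fun measurableSet_Ioi fun l hl => ?_
    simp only [oddExp, norm_mul, Real.norm_eq_abs]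
    rw [hsign (sub_ne_zero.2 hy), one_mul, abs_of_nonneg (Real.rpow_nonneg (le_of_lt hl) _),
      abs_of_pos (Real.exp_pos _)]
  have hne : ∀ᵐ y ∂volume.restrict (Ioc 0 T), y ≠ s := ae_restrict_of_ae (Measure.ae_ne volume s)
  rw [integrable_prod_iff hm.aestronglyMeasurable]
  constructor
  · filter_upwards [hne] with y hy
    refine (integrable_norm_iff (hm.comp measurable_prodMk_left).aestronglyMeasurable).1 ?_
    refine Integrable.of_integral_ne_zero ?_
    simp only [Function.comp_def]
    rw [hv hy]
    have := abs_pos.2 (sub_ne_zero.2 hy)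
    positivity
  · have hb : Integrable (fun y => Real.Gamma (1 - 2 * H) * (1 + singularPart H (y - s)))
        (volume.restrict (Ioc 0 T)) :=
      ((integrable_const 1).add
        ((integrable_singularPart hH).comp_sub_right s).integrableOn).const_mul _
    refine hb.mono' hm.aestronglyMeasurable.norm.integral_prod_right' ?_
    filter_upwards [hne] with y hy
    rw [hv hy, Real.norm_of_nonneg (by positivity)]
    have := abs_rpow_le_one_add hH (y - s)
    gcongr

lemma integral_exp_linear {a b : ℝ} (ha : a ≠ 0) (u v : ℝ) :
    ∫ y in u..v, Real.exp (a * y + b) = (Real.exp (a * v + b) - Real.exp (a * u + b)) / a := by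
  rw [sub_div]
  refine intervalIntegral.integral_eq_sub_of_hasDerivAt (f := fun y => Real.exp (a * y + b) / a)
    (fun y _ => ?_) (Continuous.intervalIntegrable (by fun_prop) _ _)
  have h := (((hasDerivAt_id y).const_mul a).add_const b).exp.div_const a
  simp only [id, mul_one] at h
  exact h.congr_deriv (mul_div_cancel_right₀ _ ha)

lemma intervalIntegrable_oddExp_mul_oddExp {l m : ℝ} (hl : 0 ≤ l) (hm : 0 ≤ m) (t s u v : ℝ) :
    IntervalIntegrable (fun y => oddExp m (y - t) * oddExp l (y - s)) volume u v := by
  have hmeas : Measurable fun y => oddExp m (y - t) * oddExp l (y - s) :=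
    (measurable_oddExp.comp (measurable_const.prodMk (measurable_id.sub_const t))).mul
      (measurable_oddExp.comp (measurable_const.prodMk (measurable_id.sub_const s)))
  refine (intervalIntegrable_const (c := (1 : ℝ))).mono_fun' hmeas.aestronglyMeasurable
    (.of_forall fun y => ?_)
  dsimp only
  rw [norm_mul]
  exact mul_le_one₀ (abs_oddExp_le hm _) (norm_nonneg _) (abs_oddExp_le hl _)

lemma integral_oddExp_mul_oddExp {l s t T : ℝ} (hl : 0 < l) (hl1 : l ≠ 1) (hs : 0 ≤ s)
    (hst : s < t) (ht : t ≤ T) :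
    ∫ y in (0 : ℝ)..T, oddExp 1 (y - t) * oddExp l (y - s) = expConv l (t - s) -
      Real.exp (-(T - t)) * (Real.exp (-(l * (T - s))) / (1 + l)) -
      Real.exp (-t) * (Real.exp (-(l * s)) / (1 + l)) := by
  have hI : ∀ u v, IntervalIntegrable (fun y => oddExp 1 (y - t) * oddExp l (y - s)) volume u v :=
    intervalIntegrable_oddExp_mul_oddExp hl.le zero_le_one t s
  have e1 : ∫ y in (0 : ℝ)..s, oddExp 1 (y - t) * oddExp l (y - s) =
      ∫ y in (0 : ℝ)..s, Real.exp ((1 + l) * y + (-t - l * s)) := by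
    refine intervalIntegral.integral_congr_Ioo_of_le hs fun y hy => ?_
    simp only [oddExp]
    rw [Real.sign_of_neg (by linarith [hy.2]), Real.sign_of_neg (by linarith [hy.2]),
      abs_of_neg (by linarith [hy.2]), abs_of_neg (by linarith [hy.2]), neg_one_mul, neg_one_mul,
      neg_mul_neg, ← Real.exp_add]
    ring_nf
  have e2 : ∫ y in s..t, oddExp 1 (y - t) * oddExp l (y - s) =
      ∫ y in s..t, -Real.exp ((1 - l) * y + (-t + l * s)) := by
    refine intervalIntegral.integral_congr_Ioo_of_le hst.le fun y hy => ?_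
    simp only [oddExp, one_mul]
    rw [Real.sign_of_neg (by linarith [hy.2]), Real.sign_of_pos (by linarith [hy.1]),
      abs_of_neg (by linarith [hy.2]), abs_of_pos (by linarith [hy.1]), neg_one_mul, one_mul,
      neg_mul, ← Real.exp_add]
    ring_nf
  have e3 : ∫ y in t..T, oddExp 1 (y - t) * oddExp l (y - s) =
      ∫ y in t..T, Real.exp (-(1 + l) * y + (t + l * s)) := by
    refine intervalIntegral.integral_congr_Ioo_of_le ht fun y hy => ?_
    simp only [oddExp, one_mul]
    rw [Real.sign_of_pos (by linarith [hy.1]), Real.sign_of_pos (by linarith [hy.1]),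
      abs_of_pos (by linarith [hy.1]), abs_of_pos (by linarith [hy.1]), one_mul, one_mul,
      ← Real.exp_add]
    ring_nf
  have h1 : (1 : ℝ) - l ≠ 0 := sub_ne_zero.2 hl1.symm
  have h2 : (1 : ℝ) + l ≠ 0 := by positivity
  rw [← intervalIntegral.integral_add_adjacent_intervals (hI 0 s) (hI s T),
    ← intervalIntegral.integral_add_adjacent_intervals (hI s t) (hI t T), e1, e2, e3,
    intervalIntegral.integral_neg, integral_exp_linear h2, integral_exp_linear h1,
    integral_exp_linear (neg_ne_zero.2 h2), expConv, abs_of_pos (sub_pos.2 hst),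
    show (1 + l) * s + (-t - l * s) = -(t - s) by ring,
    show (1 + l) * 0 + (-t - l * s) = -t + -(l * s) by ring,
    show (1 - l) * t + (-t + l * s) = -(l * (t - s)) by ring,
    show (1 - l) * s + (-t + l * s) = -(t - s) by ring,
    show -(1 + l) * T + (t + l * s) = -(T - t) + -(l * (T - s)) by ring,
    show -(1 + l) * t + (t + l * s) = -(l * (t - s)) by ring,
    Real.exp_add, Real.exp_add, show 1 - l ^ 2 = (1 - l) * (1 + l) by ring]
  generalize Real.exp (-(t - s)) = A
  generalize Real.exp (-(l * (t - s))) = B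
  field_simp
  ring

/-- The convolution of `oddExp 1` and `oddRpow H` truncated to `[0, T]`. -/
noncomputable def truncConv (H T t s : ℝ) : ℝ :=
  ∫ y in (0 : ℝ)..T, oddExp 1 (y - t) * oddRpow H (y - s)

/-- The boundary term `∫ u in Ioi 0, exp (-u) * (u + v) ^ (2 * H - 1)`. -/
noncomputable def boundaryKernel (H v : ℝ) : ℝ :=
  (Real.Gamma (1 - 2 * H))⁻¹ *
    ∫ l in Ioi (0 : ℝ), l ^ (-(2 * H)) * (Real.exp (-(l * v)) / (1 + l))

lemma norm_boundary_integrand_le {H l v : ℝ} (hl : 0 < l) (hv : 0 ≤ v) :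
    ‖l ^ (-(2 * H)) * (Real.exp (-(l * v)) / (1 + l))‖ ≤ l ^ (-(2 * H)) / (1 + l) := by
  rw [Real.norm_of_nonneg (by positivity)]
  have : Real.exp (-(l * v)) ≤ 1 := Real.exp_le_one_iff.2 (by nlinarith)
  calc _ ≤ l ^ (-(2 * H)) * (1 / (1 + l)) := by gcongr
    _ = _ := by ring

lemma integrableOn_boundary_integrand {H v : ℝ} (hH : H ∈ Ioo (0 : ℝ) (1 / 2)) (hv : 0 ≤ v) :
    IntegrableOn (fun l => l ^ (-(2 * H)) * (Real.exp (-(l * v)) / (1 + l))) (Ioi 0) :=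
  (integrableOn_rpow_div_one_add hH).mono' (Measurable.aestronglyMeasurable (by fun_prop))
    ((ae_restrict_iff' measurableSet_Ioi).2
      (.of_forall fun _ hl => norm_boundary_integrand_le hl hv))

lemma boundaryKernel_nonneg {H v : ℝ} (hH : H ∈ Ioo (0 : ℝ) (1 / 2)) : 0 ≤ boundaryKernel H v := by
  refine mul_nonneg (inv_nonneg.2 (Real.Gamma_pos_of_pos (by linarith [hH.2])).le)
    (setIntegral_nonneg measurableSet_Ioi fun l hl => ?_)
  have hl : (0 : ℝ) < l := hl
  positivity

lemma boundaryKernel_le {H v : ℝ} (hH : H ∈ Ioo (0 : ℝ) (1 / 2)) (hv : 0 ≤ v) :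
    boundaryKernel H v ≤ boundaryKernel H 0 := by
  refine mul_le_mul_of_nonneg_left ?_
    (inv_nonneg.2 (Real.Gamma_pos_of_pos (by linarith [hH.2])).le)
  refine setIntegral_mono_on (integrableOn_boundary_integrand hH hv)
    (integrableOn_boundary_integrand hH le_rfl) measurableSet_Ioi fun l hl => ?_
  have hl : (0 : ℝ) < l := hl
  have : l * 0 ≤ l * v := by gcongr
  gcongr

lemma truncConv_eq_of_lt {H s t T : ℝ} (hH : H ∈ Ioo (0 : ℝ) (1 / 2)) (hs : 0 ≤ s)
    (hst : s < t) (ht : t ≤ T) :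
    truncConv H T t s = limitKernel H (t - s) - Real.exp (-(T - t)) * boundaryKernel H (T - s) -
      Real.exp (-t) * boundaryKernel H s := by
  have hT : 0 ≤ T := by linarith
  have hint : Integrable (fun z : ℝ × ℝ => oddExp 1 (z.1 - t) *
      (z.2 ^ (-(2 * H)) * oddExp z.2 (z.1 - s)))
      ((volume.restrict (Ioc 0 T)).prod (volume.restrict (Ioi (0 : ℝ)))) := by
    refine (integrable_rpow_mul_oddExp_prod hH T s).bdd_mul (c := 1)
      (measurable_oddExp.comp
        (measurable_const.prodMk (measurable_fst.sub_const t))).aestronglyMeasurable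
      (.of_forall fun z => abs_oddExp_le zero_le_one _)
  have hswap := integral_integral_swap (f := fun y l : ℝ => oddExp 1 (y - t) *
      (l ^ (-(2 * H)) * oddExp l (y - s))) hint
  have hr : ∫ l in Ioi (0 : ℝ), ∫ y in Ioc 0 T, oddExp 1 (y - t) *
      (l ^ (-(2 * H)) * oddExp l (y - s)) = ∫ l in Ioi (0 : ℝ),
        (l ^ (-(2 * H)) * expConv l (t - s) -
          Real.exp (-(T - t)) * (l ^ (-(2 * H)) * (Real.exp (-(l * (T - s))) / (1 + l))) -
          Real.exp (-t) * (l ^ (-(2 * H)) * (Real.exp (-(l * s)) / (1 + l)))) := by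
    refine integral_congr_ae ?_
    filter_upwards [ae_restrict_mem measurableSet_Ioi,
      ae_restrict_of_ae (Measure.ae_ne volume (1 : ℝ))] with l hl hl1
    simp only [mul_left_comm _ (l ^ (-(2 * H)))]
    rw [MeasureTheory.integral_const_mul, ← intervalIntegral.integral_of_le hT,
      integral_oddExp_mul_oddExp hl hl1 hs hst ht]
    ring
  have i1 := integrableOn_rpow_mul_expConv hH (t - s)
  have i2 := (integrableOn_boundary_integrand hH (v := T - s) (by linarith)).const_mul
    (Real.exp (-(T - t)))
  have i3 := (integrableOn_boundary_integrand hH hs).const_mul (Real.exp (-t))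
  have i12 : IntegrableOn (fun l => l ^ (-(2 * H)) * expConv l (t - s) -
      Real.exp (-(T - t)) * (l ^ (-(2 * H)) * (Real.exp (-(l * (T - s))) / (1 + l)))) (Ioi 0) :=
    i1.sub i2
  rw [hr, MeasureTheory.integral_sub i12 i3, MeasureTheory.integral_sub i1 i2,
    MeasureTheory.integral_const_mul, MeasureTheory.integral_const_mul] at hswap
  rw [truncConv, intervalIntegral.integral_of_le hT]
  simp only [oddRpow_eq_integral hH]
  have e : ∀ y : ℝ, oddExp 1 (y - t) * ((Real.Gamma (1 - 2 * H))⁻¹ *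
      ∫ l in Ioi (0 : ℝ), l ^ (-(2 * H)) * oddExp l (y - s)) =
      (Real.Gamma (1 - 2 * H))⁻¹ * ∫ l in Ioi (0 : ℝ), oddExp 1 (y - t) *
        (l ^ (-(2 * H)) * oddExp l (y - s)) := by
    intro y
    rw [MeasureTheory.integral_const_mul]
    ring
  simp only [e]
  rw [MeasureTheory.integral_const_mul, hswap, limitKernel, boundaryKernel, boundaryKernel]
  ring

lemma truncConv_reflect (H T t s : ℝ) :
    truncConv H T (T - t) (T - s) = truncConv H T t s := by
  have h := intervalIntegral.integral_comp_sub_left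
    (fun y => oddExp 1 (y - (T - t)) * oddRpow H (y - (T - s))) (a := 0) (b := T) T
  rw [sub_self, sub_zero] at h
  rw [truncConv, ← h, truncConv]
  refine intervalIntegral.integral_congr fun y _ => ?_
  rw [show T - y - (T - t) = -(y - t) by ring, show T - y - (T - s) = -(y - s) by ring,
    oddExp_neg, oddRpow_neg, neg_mul_neg]

lemma truncConv_eq {H s t T : ℝ} (hH : H ∈ Ioo (0 : ℝ) (1 / 2)) (hs : s ∈ Icc 0 T)
    (ht : t ∈ Icc 0 T) (hst : s ≠ t) :
    truncConv H T t s = limitKernel H (t - s) - Real.exp (-(T - t)) * boundaryKernel H (T - s) -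
      Real.exp (-t) * boundaryKernel H s := by
  rcases hst.lt_or_gt with h | h
  · exact truncConv_eq_of_lt hH hs.1 h ht.2
  · rw [← truncConv_reflect, truncConv_eq_of_lt hH (by linarith [hs.2]) (by linarith)
      (by linarith [ht.1]), show T - t - (T - s) = -(t - s) by ring, limitKernel_neg]
    simp only [sub_sub_cancel]
    ring

lemma abs_truncConv_sub_le {H s t T : ℝ} (hH : H ∈ Ioo (0 : ℝ) (1 / 2)) (hs : s ∈ Icc 0 T)
    (ht : t ∈ Icc 0 T) (hst : s ≠ t) :
    |truncConv H T t s - limitKernel H (t - s)| ≤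
      boundaryKernel H 0 * (Real.exp (-t) + Real.exp (t - T)) := by
  have h1 := boundaryKernel_le hH hs.1
  have h2 := boundaryKernel_le hH (sub_nonneg.2 hs.2)
  have h3 := boundaryKernel_nonneg (v := s) hH
  have h4 := boundaryKernel_nonneg (v := T - s) hH
  have e (g a b : ℝ) : g - a - b - g = -(a + b) := by ring
  rw [truncConv_eq hH hs ht hst, e, abs_neg, neg_sub, abs_of_nonneg (by positivity)]
  have := Real.exp_pos (-t)
  have := Real.exp_pos (t - T)
  nlinarith

/-- The integral of `singularPart H`. -/
noncomputable def singularMass (H : ℝ) : ℝ := ∫ z, singularPart H z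

lemma singularMass_nonneg (H : ℝ) : 0 ≤ singularMass H :=
  integral_nonneg (singularPart_nonneg H)

lemma setIntegral_comp_sub_le {g : ℝ → ℝ} (hg : Integrable g) (h0 : ∀ x, 0 ≤ g x) (A : Set ℝ)
    (s : ℝ) : ∫ y in A, g (y - s) ≤ ∫ x, g x := by
  rw [← integral_sub_right_eq_self g s]
  exact setIntegral_le_integral (hg.comp_sub_right s) (.of_forall fun _ => h0 _)

lemma setIntegral_comp_sub_left_le {g : ℝ → ℝ} (hg : Integrable g) (h0 : ∀ x, 0 ≤ g x) (A : Set ℝ)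
    (t : ℝ) : ∫ y in A, g (t - y) ≤ ∫ x, g x := by
  rw [← integral_sub_left_eq_self g volume t]
  exact setIntegral_le_integral (hg.comp_sub_left t) (.of_forall fun _ => h0 _)

lemma abs_integral_mul_oddRpow_le {H T : ℝ} (hH : H ∈ Ioo (0 : ℝ) (1 / 2)) (hT : 0 ≤ T)
    {f w : ℝ → ℝ} (hw : IntegrableOn w (Ioc 0 T)) (hf : ∀ y ∈ Ioc 0 T, |f y| ≤ w y)
    (hw1 : ∀ y ∈ Ioc 0 T, w y ≤ 1) (s : ℝ) :
    |∫ y in (0 : ℝ)..T, f y * oddRpow H (y - s)| ≤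
      (∫ y in (0 : ℝ)..T, w y) + singularMass H := by
  have hS : IntegrableOn (fun y => singularPart H (y - s)) (Ioc 0 T) :=
    ((integrable_singularPart hH).comp_sub_right s).integrableOn
  rw [intervalIntegral.integral_of_le hT, intervalIntegral.integral_of_le hT, ← Real.norm_eq_abs]
  calc _ ≤ ∫ y in Ioc 0 T, (w y + singularPart H (y - s)) := by
        refine MeasureTheory.norm_integral_le_of_norm_le (hw.add hS) ?_
        filter_upwards [ae_restrict_mem measurableSet_Ioc] with y hy
        rw [norm_mul, Real.norm_eq_abs, Real.norm_eq_abs]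
        have h1 := hf y hy
        have h2 := hw1 y hy
        have h3 := abs_oddRpow_le hH (y - s)
        have h4 := abs_nonneg (f y)
        have h5 := singularPart_nonneg H (y - s)
        calc _ ≤ w y * (1 + singularPart H (y - s)) := by gcongr; linarith
          _ ≤ _ := by nlinarith
    _ ≤ _ := by
        rw [MeasureTheory.integral_add hw hS]
        gcongr
        exact setIntegral_comp_sub_le (integrable_singularPart hH) (singularPart_nonneg H) _ s

lemma integral_exp_neg_le_one (T : ℝ) : ∫ t in (0 : ℝ)..T, Real.exp (-t) ≤ 1 := by
  have h := integral_exp_linear (a := -1) (b := 0) (by norm_num) 0 T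
  simp only [neg_mul, one_mul, add_zero, neg_zero, Real.exp_zero] at h
  rw [h]
  linarith [Real.exp_pos (-T)]

lemma integral_exp_sub_le_one (T : ℝ) : ∫ t in (0 : ℝ)..T, Real.exp (t - T) ≤ 1 := by
  have h := integral_exp_linear (a := 1) (b := -T) one_ne_zero 0 T
  simp only [one_mul, add_neg_cancel, Real.exp_zero, ← sub_eq_add_neg] at h
  rw [h]
  linarith [Real.exp_pos (0 - T)]

lemma abs_I3_le {H T : ℝ} (hH : H ∈ Ioo (0 : ℝ) (1 / 2)) (hT : 0 ≤ T) :
    |I3 H T| ≤ 4 * (1 + singularMass H) ^ 2 := by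
  have h {f : ℝ → ℝ} (hf : Continuous f) (h0 : ∀ y, 0 ≤ f y) (h1 : ∀ y ∈ Ioc 0 T, f y ≤ 1)
      (hi : ∫ y in (0 : ℝ)..T, f y ≤ 1) :
      (∫ u in (0 : ℝ)..T, f u * u ^ (2 * H - 1)) ^ 2 ≤ (1 + singularMass H) ^ 2 := by
    have e : ∫ u in (0 : ℝ)..T, f u * u ^ (2 * H - 1) =
        ∫ u in (0 : ℝ)..T, f u * oddRpow H (u - 0) := by
      refine intervalIntegral.integral_congr_Ioo_of_le hT fun u hu => ?_
      simp only [oddRpow, sub_zero]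
      rw [Real.sign_of_pos hu.1, abs_of_pos hu.1, one_mul]
    rw [e]
    refine sq_le_sq' (neg_le_of_abs_le ?_) (le_of_abs_le ?_) <;>
    exact (abs_integral_mul_oddRpow_le hH hT hf.integrableOn_Ioc
      (fun y _ => (abs_of_nonneg (h0 y)).le) h1 0).trans (by gcongr)
  have a1 := h (f := fun u => Real.exp (-u)) (by fun_prop) (fun _ => (Real.exp_pos _).le)
    (fun y hy => Real.exp_le_one_iff.2 (by linarith [hy.1])) (integral_exp_neg_le_one T)
  have a2 := h (f := fun u => Real.exp (u - T)) (by fun_prop) (fun _ => (Real.exp_pos _).le)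
    (fun y hy => Real.exp_le_one_iff.2 (by linarith [hy.2])) (integral_exp_sub_le_one T)
  have e : ∫ u in (0 : ℝ)..T, Real.exp (u - T) * u ^ (2 * H - 1) =
      Real.exp (-T) * ∫ u in (0 : ℝ)..T, Real.exp u * u ^ (2 * H - 1) := by
    rw [← intervalIntegral.integral_const_mul]
    congr 1 with u
    rw [sub_eq_neg_add, Real.exp_add, mul_assoc]
  rw [e] at a2
  rw [I3, abs_of_nonneg (by positivity)]
  linarith

/-- A weight decaying exponentially away from the endpoints of `[0, T]`. -/
noncomputable def boundaryWeight (T t : ℝ) : ℝ := Real.exp (-t) + Real.exp (t - T)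

lemma boundaryWeight_nonneg (T t : ℝ) : 0 ≤ boundaryWeight T t := by
  unfold boundaryWeight; positivity

lemma continuous_boundaryWeight (T : ℝ) : Continuous (boundaryWeight T) := by
  unfold boundaryWeight; fun_prop

lemma setIntegral_boundaryWeight_le {T : ℝ} (hT : 0 ≤ T) :
    ∫ t in Ioc 0 T, boundaryWeight T t ≤ 2 := by
  rw [← intervalIntegral.integral_of_le hT]
  unfold boundaryWeight
  rw [intervalIntegral.integral_add (Continuous.intervalIntegrable (by fun_prop) _ _)
    (Continuous.intervalIntegrable (by fun_prop) _ _)]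
  linarith [integral_exp_neg_le_one T, integral_exp_sub_le_one T]

lemma I2_eq {H T : ℝ} (hT : 0 ≤ T) :
    I2 H T = 2 * ∫ t in Ioc 0 T, truncConv H T t 0 *
      ∫ u in (0 : ℝ)..T, Real.exp (-u) * oddRpow H (u - t) := by
  rw [I2, intervalIntegral.integral_of_le hT]
  congr 2 with t
  rw [← intervalIntegral.integral_const_mul]
  congr 1 with u
  rw [truncConv, ← intervalIntegral.integral_mul_const]
  refine intervalIntegral.integral_congr_Ioo_of_le hT fun s hs => ?_
  simp only [oddRpow, oddExp, sub_zero, one_mul]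
  rw [Real.sign_of_pos hs.1, abs_of_pos hs.1, sub_eq_add_neg, Real.exp_add, abs_sub_comm t s]
  ring

lemma abs_I2_le {H T : ℝ} (hH : H ∈ Ioo (0 : ℝ) (1 / 2)) (hT : 0 ≤ T) :
    |I2 H T| ≤ 2 * (((∫ x, |limitKernel H x|) + boundaryKernel H 0 * 2) *
      (1 + singularMass H)) := by
  have hG : IntegrableOn (fun t => |limitKernel H t|) (Ioc 0 T) :=
    (integrable_limitKernel hH).abs.integrableOn
  have hW : IntegrableOn (fun t => boundaryKernel H 0 * boundaryWeight T t) (Ioc 0 T) :=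
    ((continuous_boundaryWeight T).integrableOn_Ioc).const_mul _
  rw [I2_eq hT, abs_mul, abs_of_pos (zero_lt_two' ℝ)]
  gcongr
  rw [← Real.norm_eq_abs]
  calc _ ≤ ∫ t in Ioc 0 T, (|limitKernel H t| + boundaryKernel H 0 * boundaryWeight T t) *
        (1 + singularMass H) := by
        refine MeasureTheory.norm_integral_le_of_norm_le ((hG.add hW).mul_const _) ?_
        filter_upwards [ae_restrict_mem measurableSet_Ioc] with t ht
        rw [norm_mul, Real.norm_eq_abs, Real.norm_eq_abs]
        have h1 := abs_truncConv_sub_le hH ⟨le_rfl, hT⟩ ⟨ht.1.le, ht.2⟩ ht.1.ne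
        rw [sub_zero] at h1
        have h2 := abs_sub_abs_le_abs_sub (truncConv H T t 0) (limitKernel H t)
        have h3 := (abs_integral_mul_oddRpow_le hH hT (f := fun u => Real.exp (-u))
          (w := fun u => Real.exp (-u)) (Continuous.integrableOn_Ioc (by fun_prop))
          (fun y _ => (abs_of_pos (Real.exp_pos _)).le)
          (fun y hy => Real.exp_le_one_iff.2 (by linarith [hy.1])) t).trans
          (add_le_add_left (integral_exp_neg_le_one T) _)
        have h4 : |truncConv H T t 0| ≤
            |limitKernel H t| + boundaryKernel H 0 * boundaryWeight T t := by
          unfold boundaryWeight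
          linarith
        exact mul_le_mul h4 h3 (abs_nonneg _) ((abs_nonneg _).trans h4)
    _ ≤ _ := by
        rw [MeasureTheory.integral_mul_const, MeasureTheory.integral_add hG hW,
          MeasureTheory.integral_const_mul]
        have h1 := setIntegral_boundaryWeight_le hT
        have h2 := boundaryKernel_nonneg (v := 0) hH
        have h3 := singularMass_nonneg H
        have h4 : ∫ t in Ioc 0 T, |limitKernel H t| ≤ ∫ x, |limitKernel H x| :=
          setIntegral_le_integral (integrable_limitKernel hH).abs (.of_forall fun _ => abs_nonneg _)
        gcongr

lemma measurable_truncConv (H : ℝ) {T : ℝ} (hT : 0 ≤ T) :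
    Measurable fun p : ℝ × ℝ => truncConv H T p.1 p.2 := by
  unfold truncConv
  simp only [intervalIntegral.integral_of_le hT]
  have h : Measurable fun q : (ℝ × ℝ) × ℝ => oddExp 1 (q.2 - q.1.1) * oddRpow H (q.2 - q.1.2) :=
    (measurable_oddExp.comp (measurable_const.prodMk (by fun_prop))).mul
      ((measurable_oddRpow H).comp (by fun_prop))
  exact h.stronglyMeasurable.integral_prod_right'.measurable

lemma abs_truncConv_le {H T : ℝ} (hH : H ∈ Ioo (0 : ℝ) (1 / 2)) (hT : 0 ≤ T) (t s : ℝ) :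
    |truncConv H T t s| ≤ T + singularMass H := by
  have h := abs_integral_mul_oddRpow_le hH hT (f := fun y => oddExp 1 (y - t)) (w := fun _ => 1)
    (Continuous.integrableOn_Ioc continuous_const) (fun y _ => abs_oddExp_le zero_le_one _)
    (fun _ _ => le_rfl) s
  simpa [truncConv] using h

lemma integrable_prod_one_add_singularPart {H : ℝ} (hH : H ∈ Ioo (0 : ℝ) (1 / 2))
    {μ : Measure ℝ} [IsFiniteMeasure μ] (A : Set ℝ) [IsFiniteMeasure (volume.restrict A)] :
    Integrable (fun p : ℝ × ℝ => 1 + singularPart H (p.2 - p.1)) (μ.prod (volume.restrict A)) := by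
  have hm : Measurable fun p : ℝ × ℝ => singularPart H (p.2 - p.1) := by
    have : Measurable (singularPart H) :=
      ((measurable_id.pow_const _).indicator measurableSet_Iic).comp measurable_norm
    exact this.comp (by fun_prop)
  refine (integrable_const 1).add ((integrable_prod_iff hm.aestronglyMeasurable).2 ⟨?_, ?_⟩)
  · exact .of_forall fun x => ((integrable_singularPart hH).comp_sub_right x).integrableOn
  · refine (integrable_const (singularMass H)).mono'
      hm.aestronglyMeasurable.norm.integral_prod_right' (.of_forall fun x => ?_)
    rw [Real.norm_of_nonneg (integral_nonneg fun _ => norm_nonneg _)]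
    simp only [Real.norm_of_nonneg (singularPart_nonneg H _)]
    exact setIntegral_comp_sub_le (integrable_singularPart hH) (singularPart_nonneg H) _ x

lemma I1_eq_integral_truncConv {H T : ℝ} (hT : 0 ≤ T) :
    I1 H T = ∫ t₁ in Ioc 0 T, ∫ t₂ in Ioc 0 T, ∫ s in Ioc 0 T,
      oddRpow H (t₂ - t₁) * (oddExp 1 (s - t₁) * truncConv H T t₂ s) := by
  rw [I1]
  simp only [intervalIntegral.integral_of_le hT, truncConv]
  congr 1 with t₁
  congr 1 with t₂
  congr 1 with s
  rw [← MeasureTheory.integral_const_mul, ← MeasureTheory.integral_const_mul]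
  congr 1 with y
  rw [show y - t₂ = -(t₂ - y) by ring, show y - s = -(s - y) by ring, oddExp_neg, oddRpow_neg,
    neg_mul_neg]
  simp only [oddExp, oddRpow, one_mul]
  rw [sub_eq_add_neg (-|t₁ - s|), Real.exp_add, abs_sub_comm t₁ s]
  ring

lemma I1_eq {H T : ℝ} (hH : H ∈ Ioo (0 : ℝ) (1 / 2)) (hT : 0 ≤ T) :
    I1 H T = ∫ t in Ioc 0 T, ∫ s in Ioc 0 T, truncConv H T s t * truncConv H T t s := by
  set μ := volume.restrict (Ioc 0 T)
  set F : ℝ → ℝ → ℝ → ℝ := fun t₁ t₂ s =>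
    oddRpow H (t₂ - t₁) * (oddExp 1 (s - t₁) * truncConv H T t₂ s)
  have hF : Measurable fun p : (ℝ × ℝ) × ℝ => F p.1.1 p.1.2 p.2 :=
    ((measurable_oddRpow H).comp (measurable_fst.snd.sub measurable_fst.fst)).mul
      ((measurable_oddExp.comp
        (measurable_const.prodMk (measurable_snd.sub measurable_fst.fst))).mul
        ((measurable_truncConv H hT).comp (measurable_fst.snd.prodMk measurable_snd)))
  have hFb (t₁ t₂ s : ℝ) :
      ‖F t₁ t₂ s‖ ≤ (T + singularMass H) * (1 + singularPart H (t₂ - t₁)) := by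
    have h1 := abs_oddRpow_le hH (t₂ - t₁)
    have h2 := abs_truncConv_le hH hT t₂ s
    have h3 := abs_oddExp_le zero_le_one (s - t₁)
    have h4 := singularMass_nonneg H
    calc _ = |oddRpow H (t₂ - t₁)| * (|oddExp 1 (s - t₁)| * |truncConv H T t₂ s|) := by
          simp only [F, norm_mul, Real.norm_eq_abs]
      _ ≤ (1 + singularPart H (t₂ - t₁)) * (1 * (T + singularMass H)) := by
          gcongr
          exact add_nonneg zero_le_one (singularPart_nonneg H _)
      _ = _ := by ring
  have hswap₁ : Integrable (Function.uncurry fun t₁ t₂ => ∫ s, F t₁ t₂ s ∂μ) (μ.prod μ) := by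
    refine ((integrable_prod_one_add_singularPart hH (Ioc 0 T)).const_mul
      (T * (T + singularMass H))).mono'
      hF.stronglyMeasurable.integral_prod_right'.aestronglyMeasurable (.of_forall fun p => ?_)
    refine (norm_integral_le_of_norm_le_const (.of_forall (hFb p.1 p.2))).trans_eq ?_
    simp only [μ, measureReal_restrict_apply_univ, Real.volume_real_Ioc_of_le hT]
    ring
  have hswap₂ (t₂ : ℝ) : Integrable (Function.uncurry fun t₁ s => F t₁ t₂ s) (μ.prod μ) := by
    have h : Integrable (fun t₁ => 1 + singularPart H (t₁ - t₂)) μ :=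
      (integrable_const 1).add ((integrable_singularPart hH).comp_sub_right t₂).integrableOn
    refine ((h.comp_fst μ).const_mul (T + singularMass H)).mono'
      (hF.comp (((measurable_fst.prodMk measurable_const).prodMk
        measurable_snd))).aestronglyMeasurable (.of_forall fun p => ?_)
    refine (hFb p.1 t₂ p.2).trans_eq ?_
    simp only [singularPart, abs_sub_comm t₂]
  rw [I1_eq_integral_truncConv hT]
  refine (integral_integral_swap hswap₁).trans ?_
  congr 1 with t₂
  refine (integral_integral_swap (hswap₂ t₂)).trans ?_
  congr 1 with s
  rw [truncConv, intervalIntegral.integral_of_le hT, ← MeasureTheory.integral_mul_const]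
  congr 1 with t₁
  simp only [F]
  rw [show t₂ - t₁ = -(t₁ - t₂) by ring, show s - t₁ = -(t₁ - s) by ring, oddRpow_neg, oddExp_neg]
  ring

lemma abs_integral_comp_sub_sub_le {g : ℝ → ℝ} (hg : Integrable g)
    (hg' : Integrable fun x => |x| * g x) (h0 : ∀ x, 0 ≤ g x) {T : ℝ} (hT : 0 ≤ T) :
    |(∫ t in Ioc 0 T, ∫ s in Ioc 0 T, g (t - s)) - T * ∫ x, g x| ≤ ∫ x, |x| * g x := by
  have hi : Integrable (Function.uncurry fun t x : ℝ => (Ioc 0 T).indicator 1 (t - x) * g x)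
      ((volume.restrict (Ioc 0 T)).prod volume) := by
    refine (hg.comp_snd _).bdd_mul (c := 1) ?_ (.of_forall fun p => ?_)
    · have : Measurable ((Ioc 0 T).indicator (1 : ℝ → ℝ)) :=
        measurable_one.indicator measurableSet_Ioc
      exact (this.comp (by fun_prop : Measurable fun p : ℝ × ℝ => p.1 - p.2)).aestronglyMeasurable
    · refine (norm_indicator_le_norm_self _ _).trans ?_
      simp
  have e1 : ∫ t in Ioc 0 T, ∫ s in Ioc 0 T, g (t - s) =
      ∫ x, (∫ t in Ioc 0 T, (Ioc 0 T).indicator (1 : ℝ → ℝ) (t - x)) * g x := by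
    simp only [← MeasureTheory.integral_mul_const]
    rw [← integral_integral_swap hi]
    congr 1 with t
    rw [← integral_sub_left_eq_self _ volume t,
      ← MeasureTheory.integral_indicator measurableSet_Ioc]
    congr 1 with s
    by_cases hs : s ∈ Ioc 0 T <;> simp [hs]
  have e2 (x : ℝ) : ∫ t in Ioc 0 T, (Ioc 0 T).indicator (1 : ℝ → ℝ) (t - x) =
      max (min T (T + x) - max 0 x) 0 := by
    have : (fun t => (Ioc 0 T).indicator (1 : ℝ → ℝ) (t - x)) =
        (Ioc x (T + x)).indicator 1 := by
      ext t
      simp only [indicator, mem_Ioc, sub_pos, sub_le_iff_le_add]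
      rfl
    rw [this, setIntegral_indicator measurableSet_Ioc, Ioc_inter_Ioc]
    simp
  have e3 (x : ℝ) : |max (min T (T + x) - max 0 x) 0 - T| ≤ |x| := by
    grind
  have hm : Integrable fun x => max (min T (T + x) - max 0 x) 0 * g x := by
    refine hi.integral_prod_right.congr (.of_forall fun x => ?_)
    simp only [Function.uncurry_apply_pair]
    rw [MeasureTheory.integral_mul_const, e2]
  rw [e1]
  simp only [e2]
  rw [← MeasureTheory.integral_const_mul, ← MeasureTheory.integral_sub hm (hg.const_mul T),
    ← Real.norm_eq_abs]
  refine MeasureTheory.norm_integral_le_of_norm_le hg' (.of_forall fun x => ?_)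
  rw [← sub_mul, norm_mul, Real.norm_eq_abs, Real.norm_of_nonneg (h0 x)]
  exact mul_le_mul_of_nonneg_right (e3 x) (h0 x)

lemma integrable_prod_Ioc_of_continuous {f : ℝ × ℝ → ℝ} (hf : Continuous f) (a b : ℝ) :
    Integrable f ((volume.restrict (Ioc a b)).prod (volume.restrict (Ioc a b))) := by
  rw [Measure.prod_restrict]
  exact (hf.continuousOn.integrableOn_compact (isCompact_Icc.prod isCompact_Icc)).mono_set
    (prod_mono Ioc_subset_Icc_self Ioc_subset_Icc_self)

lemma abs_mul_truncConv_sub_sq_le {H s t T : ℝ} (hH : H ∈ Ioo (0 : ℝ) (1 / 2)) (hs : s ∈ Icc 0 T)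
    (ht : t ∈ Icc 0 T) (hst : s ≠ t) :
    |truncConv H T s t * truncConv H T t s - limitKernel H (t - s) ^ 2| ≤
      boundaryKernel H 0 * (|limitKernel H (t - s)| * boundaryWeight T t) +
      boundaryKernel H 0 * (|limitKernel H (t - s)| * boundaryWeight T s) +
      boundaryKernel H 0 ^ 2 * (boundaryWeight T t * boundaryWeight T s) := by
  have h1 := abs_truncConv_sub_le hH hs ht hst
  have h2 := abs_truncConv_sub_le hH ht hs hst.symm
  rw [show s - t = -(t - s) by ring, limitKernel_neg] at h2
  set G := limitKernel H (t - s)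
  set P := boundaryKernel H 0
  change _ ≤ P * boundaryWeight T t at h1
  change _ ≤ P * boundaryWeight T s at h2
  calc _ = |G * (truncConv H T t s - G) + G * (truncConv H T s t - G) +
        (truncConv H T t s - G) * (truncConv H T s t - G)| := by ring_nf
    _ ≤ |G| * |truncConv H T t s - G| + |G| * |truncConv H T s t - G| +
        |truncConv H T t s - G| * |truncConv H T s t - G| := by
      simp only [← abs_mul]
      exact abs_add_three _ _ _
    _ ≤ |G| * (P * boundaryWeight T t) + |G| * (P * boundaryWeight T s) +
        (P * boundaryWeight T t) * (P * boundaryWeight T s) := by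
      gcongr
      exact (abs_nonneg _).trans h1
    _ = _ := by ring

lemma abs_I1_sub_integral_limitKernel_le {H T : ℝ} (hH : H ∈ Ioo (0 : ℝ) (1 / 2)) (hT : 0 ≤ T) :
    |I1 H T - ∫ t in Ioc 0 T, ∫ s in Ioc 0 T, limitKernel H (t - s) ^ 2| ≤
      4 * boundaryKernel H 0 * (∫ x, |limitKernel H x|) + 4 * boundaryKernel H 0 ^ 2 := by
  set μ := volume.restrict (Ioc 0 T)
  set P := boundaryKernel H 0
  set N := ∫ x, |limitKernel H x|
  have hG := continuous_limitKernel hH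
  have hGi := (integrable_limitKernel hH).abs
  have hW := continuous_boundaryWeight T
  have hWi : Integrable (boundaryWeight T) μ := hW.integrableOn_Ioc
  have hA : Integrable (fun p : ℝ × ℝ => truncConv H T p.2 p.1 * truncConv H T p.1 p.2)
      (μ.prod μ) := by
    have hm := measurable_truncConv H hT
    refine Integrable.of_bound ((hm.comp measurable_swap).mul hm).aestronglyMeasurable
      ((T + singularMass H) * (T + singularMass H)) (.of_forall fun p => ?_)
    rw [norm_mul]
    have h (a b : ℝ) := abs_truncConv_le hH hT a b
    exact mul_le_mul (h _ _) (h _ _) (norm_nonneg _) ((abs_nonneg _).trans (h 0 0))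
  have hGs : Integrable (fun p : ℝ × ℝ => limitKernel H (p.1 - p.2) ^ 2) (μ.prod μ) :=
    integrable_prod_Ioc_of_continuous (by fun_prop) 0 T
  have i1 : Integrable (fun p : ℝ × ℝ => |limitKernel H (p.1 - p.2)| * boundaryWeight T p.1)
      (μ.prod μ) := integrable_prod_Ioc_of_continuous (by fun_prop) 0 T
  have i2 : Integrable (fun p : ℝ × ℝ => |limitKernel H (p.1 - p.2)| * boundaryWeight T p.2)
      (μ.prod μ) := integrable_prod_Ioc_of_continuous (by fun_prop) 0 T
  have i3 : Integrable (fun p : ℝ × ℝ => boundaryWeight T p.1 * boundaryWeight T p.2)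
      (μ.prod μ) := hWi.mul_prod hWi
  have hw : ∫ t, boundaryWeight T t ∂μ ≤ 2 := setIntegral_boundaryWeight_le hT
  have hw0 : 0 ≤ ∫ t, boundaryWeight T t ∂μ := integral_nonneg (boundaryWeight_nonneg T)
  have hN : 0 ≤ N := integral_nonneg fun _ => abs_nonneg _
  have hP : 0 ≤ P := boundaryKernel_nonneg hH
  have b1 : ∫ p, |limitKernel H (p.1 - p.2)| * boundaryWeight T p.1 ∂μ.prod μ ≤ N * 2 := by
    rw [integral_prod _ i1]
    refine (integral_mono i1.integral_prod_left (hWi.const_mul N) fun t => ?_).trans ?_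
    · dsimp only
      rw [MeasureTheory.integral_mul_const]
      exact mul_le_mul_of_nonneg_right
        (setIntegral_comp_sub_left_le hGi (fun _ => abs_nonneg _) _ t) (boundaryWeight_nonneg T t)
    · rw [MeasureTheory.integral_const_mul]
      gcongr
  have b2 : ∫ p, |limitKernel H (p.1 - p.2)| * boundaryWeight T p.2 ∂μ.prod μ ≤ N * 2 := by
    rw [integral_prod_symm _ i2]
    refine (integral_mono i2.integral_prod_right (hWi.const_mul N) fun s => ?_).trans ?_
    · dsimp only
      rw [MeasureTheory.integral_mul_const]
      exact mul_le_mul_of_nonneg_right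
        (setIntegral_comp_sub_le hGi (fun _ => abs_nonneg _) _ s) (boundaryWeight_nonneg T s)
    · rw [MeasureTheory.integral_const_mul]
      gcongr
  have b3 : ∫ p : ℝ × ℝ, boundaryWeight T p.1 * boundaryWeight T p.2 ∂μ.prod μ ≤ 2 * 2 := by
    rw [integral_prod_mul]
    gcongr
  have hne : ∀ᵐ p : ℝ × ℝ ∂μ.prod μ, p.1 ≠ p.2 := by
    refine (Measure.ae_prod_iff_ae_ae (p := fun p : ℝ × ℝ => p.1 ≠ p.2)
      (measurableSet_eq_fun measurable_fst measurable_snd).compl).2 ?_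
    exact .of_forall fun t => (ae_restrict_of_ae (Measure.ae_ne volume t)).mono fun s => Ne.symm
  have hmem : ∀ᵐ p : ℝ × ℝ ∂μ.prod μ, p ∈ Ioc 0 T ×ˢ Ioc 0 T := by
    rw [Measure.prod_restrict]
    exact ae_restrict_mem (measurableSet_Ioc.prod measurableSet_Ioc)
  have key : |∫ p : ℝ × ℝ, (truncConv H T p.2 p.1 * truncConv H T p.1 p.2 -
      limitKernel H (p.1 - p.2) ^ 2) ∂μ.prod μ| ≤
      P * (N * 2) + P * (N * 2) + P ^ 2 * (2 * 2) := by
    rw [← Real.norm_eq_abs]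
    refine (MeasureTheory.norm_integral_le_of_norm_le
      (((i1.const_mul P).add (i2.const_mul P)).add (i3.const_mul (P ^ 2))) ?_).trans ?_
    · filter_upwards [hne, hmem] with p hp ⟨h1, h2⟩
      exact abs_mul_truncConv_sub_sq_le hH ⟨h2.1.le, h2.2⟩ ⟨h1.1.le, h1.2⟩ hp.symm
    · rw [integral_add' ((i1.const_mul P).add (i2.const_mul P)) (i3.const_mul _),
        integral_add' (i1.const_mul P) (i2.const_mul P),
        MeasureTheory.integral_const_mul, MeasureTheory.integral_const_mul,
        MeasureTheory.integral_const_mul]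
      gcongr
  rw [MeasureTheory.integral_sub hA hGs, integral_prod _ hA, integral_prod _ hGs] at key
  rw [I1_eq hH hT]
  exact key.trans_eq (by ring)

lemma exists_abs_I1_sub_le {H : ℝ} (hH : H ∈ Ioo (0 : ℝ) (1 / 2)) :
    ∃ C, ∀ T, 0 ≤ T → |I1 H T - T * ∫ x, limitKernel H x ^ 2| ≤ C := by
  obtain ⟨C, hC⟩ := exists_abs_limitKernel_le hH
  have hG := continuous_limitKernel hH
  have hGi := (integrable_limitKernel hH).abs
  have i1 : Integrable fun x => limitKernel H x ^ 2 := by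
    refine (hGi.const_mul C).mono' (by fun_prop) (.of_forall fun x => ?_)
    rw [Real.norm_of_nonneg (sq_nonneg _), ← sq_abs, sq]
    exact mul_le_mul_of_nonneg_right (hC x).1 (abs_nonneg _)
  have i2 : Integrable fun x => |x| * limitKernel H x ^ 2 := by
    refine (hGi.const_mul C).mono' (by fun_prop) (.of_forall fun x => ?_)
    rw [Real.norm_of_nonneg (by positivity), ← sq_abs (limitKernel H x), sq, ← mul_assoc]
    exact mul_le_mul_of_nonneg_right (hC x).2 (abs_nonneg _)
  refine ⟨_, fun T hT => (abs_sub_le _ _ _).trans (add_le_add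
    (abs_I1_sub_integral_limitKernel_le hH hT)
    (abs_integral_comp_sub_sub_le i1 i2 (fun _ => sq_nonneg _) hT))⟩

theorem stmt_9 (H : ℝ) (hH : H ∈ Set.Ioo (0 : ℝ) (1/2)) :
    ∃ C > (0 : ℝ), ∀ T ≥ (1 : ℝ),
      |fBmNormSqM H T / (2 * T) - H ^ 2 * (Real.Gamma (2 * H)) ^ 2 * sigmaH2 H| ≤ C / T := by
  obtain ⟨C, hC⟩ := exists_abs_I1_sub_le hH
  set C₂ := 2 * (((∫ x, |limitKernel H x|) + boundaryKernel H 0 * 2) * (1 + singularMass H))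
  set C₃ := 4 * (1 + singularMass H) ^ 2
  have hC₀ : 0 ≤ C := (abs_nonneg _).trans (hC 1 zero_le_one)
  have hC₂ : 0 ≤ C₂ := (abs_nonneg _).trans (abs_I2_le hH zero_le_one)
  have hH2 : 0 < H ^ 2 := pow_pos hH.1 2
  refine ⟨H ^ 2 * (C + 2 * C₂ + C₃ + 1), by positivity, fun T hT => ?_⟩
  have hT : 0 < T := by linarith
  have h1 := abs_le.1 (hC T hT.le)
  have h2 := abs_le.1 (abs_I2_le hH hT.le)
  have h3 := abs_le.1 (abs_I3_le hH hT.le)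
  rw [integral_limitKernel_sq hH] at h1
  set S := Real.Gamma (2 * H) ^ 2 * sigmaH2 H
  have e : fBmNormSqM H T / (2 * T) - H ^ 2 * (Real.Gamma (2 * H)) ^ 2 * sigmaH2 H =
      H ^ 2 * ((I1 H T - T * (2 * S) + 2 * I2 H T + I3 H T) / 2) / T := by
    rw [fBmNormSqM]
    simp only [S]
    field_simp
    ring
  rw [e, abs_div, abs_mul, abs_of_pos hH2, abs_of_pos hT]
  gcongr
  rw [abs_le]
  constructor <;> linarith [h1.1, h1.2, h2.1, h2.2, h3.1, h3.2, sq_nonneg (1 + singularMass H)]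
end

section
/- Let β ∈ (−1, 0). Then, as T → ∞, e^{−T}·∫₀^T e^x x^β dx = T^β − β·T^{β−1} + β(β−1)·T^{β−2} + O(T^{β−3}). -/
open Real MeasureTheory intervalIntegral

lemma intervalIntegrable_exp_mul_rpow {β : ℝ} (hβ : -1 < β) (a b : ℝ) :
    IntervalIntegrable (fun x : ℝ => Real.exp x * x ^ β) volume a b :=
  (intervalIntegrable_rpow' hβ).continuousOn_mul Real.continuous_exp.continuousOn

lemma hasDerivAt_integral_exp_mul_rpow {β x : ℝ} (hβ : -1 < β) (hx : 0 < x) :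
    HasDerivAt (fun T => ∫ t in (0:ℝ)..T, Real.exp t * t ^ β) (Real.exp x * x ^ β) x := by
  refine integral_hasDerivAt_right (intervalIntegrable_exp_mul_rpow hβ 0 x) ?_ ?_
  · have hmeas : Measurable fun t : ℝ => Real.exp t * t ^ β := by fun_prop
    exact hmeas.stronglyMeasurable.stronglyMeasurableAtFilter
  · exact Real.continuous_exp.continuousAt.mul
      (Real.continuousAt_rpow_const x β (Or.inl hx.ne'))

lemma hasDerivAt_exp_mul_rpow {x : ℝ} (s : ℝ) (hx : 0 < x) :
    HasDerivAt (fun t => Real.exp t * t ^ s)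
      (Real.exp x * (x ^ s + s * x ^ (s - 1))) x :=
  ((Real.hasDerivAt_exp x).mul (Real.hasDerivAt_rpow_const (Or.inl hx.ne'))).congr_deriv
    (by ring)

/-- The error of the three-term expansion, multiplied by `exp T`, has derivative
`-β (β - 1) (β - 2) exp T * T ^ (β - 3)`. -/
lemma hasDerivAt_integral_sub_expansion {β x : ℝ} (hβ : -1 < β) (hx : 0 < x) :
    HasDerivAt (fun T => (∫ t in (0:ℝ)..T, Real.exp t * t ^ β) -
        (Real.exp T * T ^ β - β * (Real.exp T * T ^ (β - 1)) +
          β * (β - 1) * (Real.exp T * T ^ (β - 2))))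
      (-(β * (β - 1) * (β - 2)) * (Real.exp x * x ^ (β - 3))) x := by
  refine ((hasDerivAt_integral_exp_mul_rpow hβ hx).sub
    (((hasDerivAt_exp_mul_rpow β hx).sub ((hasDerivAt_exp_mul_rpow (β - 1) hx).const_mul β)).add
      ((hasDerivAt_exp_mul_rpow (β - 2) hx).const_mul (β * (β - 1))))).congr_deriv ?_
  rw [show β - 1 - 1 = β - 2 by ring, show β - 2 - 1 = β - 3 by ring]
  ring

theorem stmt_11 (β : ℝ) (hβ : β ∈ Set.Ioo (-1 : ℝ) 0) :
    ∃ M c : ℝ, ∀ T > c,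
      |Real.exp (-T) * (∫ x in (0:ℝ)..T, Real.exp x * x ^ β) -
          (T ^ β - β * T ^ (β - 1) + β * (β - 1) * T ^ (β - 2))|
        ≤ M * T ^ (β - 3) := by
  obtain ⟨hβ₁, hβ₀⟩ := hβ
  set E : ℝ → ℝ := fun T => (∫ t in (0:ℝ)..T, Real.exp t * t ^ β) -
        (Real.exp T * T ^ β - β * (Real.exp T * T ^ (β - 1)) +
          β * (β - 1) * (Real.exp T * T ^ (β - 2))) with hE
  set K : ℝ := |-(β * (β - 1) * (β - 2))|
  have hF (x : ℝ) (hx : 0 < x) : 0 < Real.exp x * x ^ (β - 3) := by positivity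
  set M : ℝ := 2 * K + |E 8| / (Real.exp 8 * (8:ℝ) ^ (β - 3)) with hM
  have hMK : 2 * K ≤ M := le_add_of_nonneg_right (by positivity)
  have hM8 : |E 8| ≤ M * (Real.exp 8 * (8:ℝ) ^ (β - 3)) := by
    rw [hM, add_mul, div_mul_cancel₀ _ (hF 8 (by norm_num)).ne']
    exact le_add_of_nonneg_left (by positivity)
  have hE' (x : ℝ) (hx : 0 < x) := hasDerivAt_integral_sub_expansion hβ₁ hx
  have hF' (x : ℝ) (hx : 0 < x) := (hasDerivAt_exp_mul_rpow (β - 3) hx).const_mul M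
  refine ⟨M, 8, fun T hT => ?_⟩
  have hbound : ‖E T‖ ≤ M * (Real.exp T * T ^ (β - 3)) := by
    refine image_norm_le_of_norm_deriv_right_le_deriv_boundary' (a := 8) (b := T)
      (fun x hx => (hE' x (by linarith [hx.1])).continuousAt.continuousWithinAt)
      (fun x hx => (hE' x (by linarith [hx.1])).hasDerivWithinAt) hM8
      (fun x hx => (hF' x (by linarith [hx.1])).continuousAt.continuousWithinAt)
      (fun x hx => (hF' x (by linarith [hx.1])).hasDerivWithinAt)
      (fun x hx => ?_) ⟨hT.le, le_rfl⟩
    have hx8 : 8 ≤ x := hx.1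
    have hx0 : 0 < x := by linarith
    rw [norm_mul, Real.norm_eq_abs, Real.norm_eq_abs, abs_of_pos (hF x hx0),
      Real.rpow_sub_one hx0.ne']
    have hratio : 1 / 2 ≤ 1 + (β - 3) / x := by
      have : -(1 / 2) ≤ (β - 3) / x := by
        rw [le_div_iff₀ hx0]
        linarith
      linarith
    have hKM : K ≤ M * (1 + (β - 3) / x) := by
      have hM0 : 0 ≤ M := le_trans (by positivity) hMK
      nlinarith
    calc K * (Real.exp x * x ^ (β - 3))
        ≤ M * (1 + (β - 3) / x) * (Real.exp x * x ^ (β - 3)) :=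
          mul_le_mul_of_nonneg_right hKM (hF x hx0).le
      _ = _ := by ring
  have hexp : Real.exp (-T) * Real.exp T = 1 := by rw [← Real.exp_add]; simp
  have hfactor : Real.exp (-T) * (∫ x in (0:ℝ)..T, Real.exp x * x ^ β) -
      (T ^ β - β * T ^ (β - 1) + β * (β - 1) * T ^ (β - 2)) = Real.exp (-T) * E T := by
    simp only [hE]
    linear_combination (T ^ β - β * T ^ (β - 1) + β * (β - 1) * T ^ (β - 2)) * hexp
  rw [hfactor, abs_mul, Real.abs_exp]
  calc Real.exp (-T) * |E T| ≤ Real.exp (-T) * (M * (Real.exp T * T ^ (β - 3))) :=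
        mul_le_mul_of_nonneg_left hbound (Real.exp_pos _).le
    _ = M * T ^ (β - 3) := by linear_combination M * T ^ (β - 3) * hexp
end

section
/- As T → ∞, ∫₀¹ (1/√(1−t))·((1−e^{−tT})/t) dt = log T + 2·log 2 + γ − 1/(2T) − 3/(8T²) + O(T^{−3}), where γ is the Euler–Mascheroni constant (γ = ∫₀¹ (1 − e^{−u} − e^{−1/u})/u du). -/
open Real MeasureTheory intervalIntegral

lemma hasDerivAt_neg_exp_neg_mul (T t : ℝ) :
    HasDerivAt (fun t => -Real.exp (-(t * T))) (Real.exp (-(t * T)) * T) t := by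
  simpa using! (((hasDerivAt_id t).mul_const T).neg.exp).neg

lemma hasDerivAt_neg_exp_mul_poly (T t : ℝ) (hT : T ≠ 0) :
    HasDerivAt (fun t => -Real.exp (-(t * T)) * (t ^ 2 / T + 2 * t / T ^ 2 + 2 / T ^ 3))
      (t ^ 2 * Real.exp (-(t * T))) t := by
  have h2 : HasDerivAt (fun t => t ^ 2 / T + 2 * t / T ^ 2 + 2 / T ^ 3)
      (2 * t / T + 2 / T ^ 2) t := by
    simpa using ((((hasDerivAt_pow 2 t).div_const T).add
      (((hasDerivAt_id t).const_mul 2).div_const (T ^ 2))).add_const (2 / T ^ 3))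
  convert! (hasDerivAt_neg_exp_neg_mul T t).mul h2 using 1
  field_simp
  ring

lemma integral_sq_mul_exp_le {T : ℝ} (hT : 0 < T) :
    ∫ t in (0:ℝ)..1, t ^ 2 * Real.exp (-(t * T)) ≤ 2 / T ^ 3 := by
  rw [integral_eq_sub_of_hasDerivAt (fun t _ => hasDerivAt_neg_exp_mul_poly T t hT.ne')
    ((by fun_prop : Continuous _).intervalIntegrable _ _)]
  have : 0 ≤ Real.exp (-(1 * T)) * (1 ^ 2 / T + 2 * 1 / T ^ 2 + 2 / T ^ 3) := by positivity
  simp at this ⊢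
  linarith

lemma integral_exp_mul_affine {T : ℝ} (hT : 0 < T) :
    ∫ t in (0:ℝ)..1, Real.exp (-(t * T)) * (1 / 2 + 3 * t / 8) =
      1 / (2 * T) + 3 / (8 * T ^ 2) - Real.exp (-T) * (7 / (8 * T) + 3 / (8 * T ^ 2)) := by
  have h (t : ℝ) : HasDerivAt
      (fun t => -Real.exp (-(t * T)) * ((1 / 2 + 3 * t / 8) / T + 3 / (8 * T ^ 2)))
      (Real.exp (-(t * T)) * (1 / 2 + 3 * t / 8)) t := by
    have h2 : HasDerivAt (fun t => (1 / 2 + 3 * t / 8) / T + 3 / (8 * T ^ 2)) (3 * 1 / 8 / T) t :=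
      (((((hasDerivAt_id t).const_mul 3).div_const 8).const_add (1 / 2)).div_const
        T).add_const (3 / (8 * T ^ 2))
    convert! (hasDerivAt_neg_exp_neg_mul T t).mul h2 using 1
    field_simp
    ring
  rw [integral_eq_sub_of_hasDerivAt (fun t _ => h t)
    ((by fun_prop : Continuous _).intervalIntegrable _ _)]
  simp
  field_simp
  ring

lemma hasDerivAt_sqrt_one_sub {t : ℝ} (ht : t < 1) :
    HasDerivAt (fun t => √(1 - t)) (-(1 / (2 * √(1 - t)))) t := by
  simpa [neg_div] using ((hasDerivAt_id t).const_sub 1).sqrt (by simp; linarith)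

lemma integral_one_div_sqrt_one_sub :
    IntervalIntegrable (fun t => 1 / √(1 - t)) volume 0 1 ∧
      ∫ t in (0:ℝ)..1, 1 / √(1 - t) = 2 := by
  have hc : ContinuousOn (fun t : ℝ => -2 * √(1 - t)) (Set.Icc 0 1) := by fun_prop
  have hd : ∀ t ∈ Set.Ioo (0:ℝ) 1, HasDerivAt (fun t : ℝ => -2 * √(1 - t)) (1 / √(1 - t)) t := by
    intro t ht
    convert! (hasDerivAt_sqrt_one_sub ht.2).const_mul (-2) using 1
    field
  have hi : IntervalIntegrable (fun t => 1 / √(1 - t)) volume 0 1 := by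
    rw [intervalIntegrable_iff_integrableOn_Ioc_of_le zero_le_one]
    exact integrableOn_deriv_of_nonneg hc hd fun t _ => by positivity
  refine ⟨hi, ?_⟩
  rw [integral_eq_sub_of_hasDerivAt_of_le zero_le_one hc hd hi]
  simp

lemma integral_one_div_sqrt_mul :
    IntervalIntegrable (fun t => 1 / (√(1 - t) * (1 + √(1 - t)))) volume 0 1 ∧
      ∫ t in (0:ℝ)..1, 1 / (√(1 - t) * (1 + √(1 - t))) = 2 * Real.log 2 := by
  have hc : ContinuousOn (fun t : ℝ => -2 * Real.log (1 + √(1 - t))) (Set.Icc 0 1) := by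
    refine Continuous.continuousOn (continuous_const.mul (Continuous.log (by fun_prop) ?_))
    intro x; positivity
  have hd : ∀ t ∈ Set.Ioo (0:ℝ) 1, HasDerivAt (fun t : ℝ => -2 * Real.log (1 + √(1 - t)))
      (1 / (√(1 - t) * (1 + √(1 - t)))) t := by
    intro t ht
    have hs : 0 < √(1 - t) := Real.sqrt_pos.2 (by linarith [ht.2])
    convert! (((hasDerivAt_sqrt_one_sub ht.2).const_add 1).log (by positivity)).const_mul (-2)
      using 1
    field
  have hi : IntervalIntegrable (fun t => 1 / (√(1 - t) * (1 + √(1 - t)))) volume 0 1 := by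
    rw [intervalIntegrable_iff_integrableOn_Ioc_of_le zero_le_one]
    exact integrableOn_deriv_of_nonneg hc hd fun t _ => by positivity
  refine ⟨hi, ?_⟩
  rw [integral_eq_sub_of_hasDerivAt_of_le zero_le_one hc hd hi]
  norm_num

lemma integral_exp_neg_mul_log :
    IntegrableOn (fun u => Real.exp (-u) * Real.log u) (Set.Ioi 0) ∧
      ∫ u in Set.Ioi (0:ℝ), Real.exp (-u) * Real.log u = -Real.eulerMascheroniConstant := by
  have h1 := Complex.hasDerivAt_GammaIntegral (s := 1) (by simp)
  have h2 : HasDerivAt Complex.GammaIntegral (-(Real.eulerMascheroniConstant : ℂ)) 1 := by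
    refine Complex.hasDerivAt_Gamma_one.congr_of_eventuallyEq ?_
    have : {s : ℂ | 0 < s.re} ∈ nhds (1 : ℂ) :=
      (isOpen_lt continuous_const Complex.continuous_re).mem_nhds (by simp)
    filter_upwards [this] with s hs using (Complex.Gamma_eq_integral hs).symm
  have h3 := h1.unique h2
  have h4 : ∫ u in Set.Ioi (0:ℝ), Real.exp (-u) * Real.log u = -Real.eulerMascheroniConstant := by
    rw [← Complex.ofReal_inj, ← integral_complex_ofReal]
    push_cast
    rw [← h3]
    congr 1
    ext u
    simp [mul_comm]
  refine ⟨Integrable.of_integral_ne_zero ?_, h4⟩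
  rw [h4]
  exact (by linarith [one_half_lt_eulerMascheroniConstant] : -eulerMascheroniConstant < 0).ne

lemma abs_one_div_sqrt_mul_sub_le {t : ℝ} (h0 : 0 < t) (h1 : t < 1) :
    |1 / (√(1 - t) * (1 + √(1 - t))) - (1 / 2 + 3 * t / 8)| ≤ t ^ 2 / √(1 - t) := by
  have hs : 0 < √(1 - t) := Real.sqrt_pos.2 (by linarith)
  have ht : t = 1 - √(1 - t) ^ 2 := by rw [Real.sq_sqrt (by linarith)]; ring
  generalize √(1 - t) = s at hs ht
  subst ht
  have e : 1 / (s * (1 + s)) - (1 / 2 + 3 * (1 - s ^ 2) / 8) =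
      (1 - s) ^ 2 * (3 * s ^ 2 + 9 * s + 8) / (8 * s * (1 + s)) := by
    field
  have e' : (1 - s ^ 2) ^ 2 / s =
      (1 - s) ^ 2 * (8 * (1 + s) ^ 3) / (8 * s * (1 + s)) := by
    field
  rw [e, e', abs_of_nonneg (by positivity)]
  gcongr
  nlinarith [pow_pos hs 2, pow_pos hs 3]

lemma exp_neg_mul_sq_div_sqrt_le {t T : ℝ} (h0 : 0 < t) (h1 : t < 1) (hT : 0 < T) :
    Real.exp (-(t * T)) * (t ^ 2 / √(1 - t)) ≤
      t ^ 2 * Real.exp (-(t * T)) + 6 / T ^ 3 * (1 / √(1 - t)) := by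
  have hs : 0 < √(1 - t) := Real.sqrt_pos.2 (by linarith)
  have hs1 : √(1 - t) ≤ 1 := Real.sqrt_le_one.2 (by linarith)
  have ht : t = 1 - √(1 - t) ^ 2 := by rw [Real.sq_sqrt (by linarith)]; ring
  have hinv : 1 / √(1 - t) ≤ 1 + t / √(1 - t) := by
    rw [div_le_iff₀ hs, add_mul, div_mul_cancel₀ _ hs.ne']
    nlinarith
  have hexp : Real.exp (-(t * T)) * t ^ 3 ≤ 6 / T ^ 3 := by
    have := Real.pow_div_factorial_le_exp (x := t * T) (by positivity) 3
    rw [Real.exp_neg, le_div_iff₀ (by positivity), mul_assoc, ← mul_pow,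
      inv_mul_le_iff₀ (Real.exp_pos _)]
    norm_num [Nat.factorial] at this
    linarith
  calc Real.exp (-(t * T)) * (t ^ 2 / √(1 - t))
      = t ^ 2 * Real.exp (-(t * T)) * (1 / √(1 - t)) := by ring
    _ ≤ t ^ 2 * Real.exp (-(t * T)) * (1 + t / √(1 - t)) := by gcongr
    _ = t ^ 2 * Real.exp (-(t * T)) + Real.exp (-(t * T)) * t ^ 3 * (1 / √(1 - t)) := by ring
    _ ≤ _ := by gcongr

lemma abs_integral_remainder_le {T : ℝ} (hT : 0 < T) :
    |∫ t in (0:ℝ)..1, Real.exp (-(t * T)) *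
      (1 / (√(1 - t) * (1 + √(1 - t))) - (1 / 2 + 3 * t / 8))| ≤ 14 / T ^ 3 := by
  obtain ⟨hi, hv⟩ := integral_one_div_sqrt_one_sub
  have hi1 : IntervalIntegrable (fun t : ℝ => t ^ 2 * Real.exp (-(t * T))) volume 0 1 :=
    Continuous.intervalIntegrable (by fun_prop) _ _
  have hi2 := hi.const_mul (6 / T ^ 3)
  have h := norm_integral_le_of_norm_le (μ := volume) (f := fun t : ℝ => Real.exp (-(t * T)) *
      (1 / (√(1 - t) * (1 + √(1 - t))) - (1 / 2 + 3 * t / 8))) zero_le_one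
    (g := fun t => t ^ 2 * Real.exp (-(t * T)) + 6 / T ^ 3 * (1 / √(1 - t))) ?_ (hi1.add hi2)
  · rw [integral_add hi1 hi2, intervalIntegral.integral_const_mul, hv, Real.norm_eq_abs] at h
    have := integral_sq_mul_exp_le hT
    calc _ ≤ _ := h
      _ ≤ 2 / T ^ 3 + 6 / T ^ 3 * 2 := by gcongr
      _ = _ := by ring
  · filter_upwards [volume.ae_ne (1 : ℝ)] with t ht1 ht
    have ht1 := lt_of_le_of_ne ht.2 ht1
    rw [norm_mul, Real.norm_eq_abs, Real.norm_eq_abs, Real.abs_exp]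
    exact (mul_le_mul_of_nonneg_left (abs_one_div_sqrt_mul_sub_le ht.1 ht1) (Real.exp_nonneg _)).trans
      (exp_neg_mul_sq_div_sqrt_le ht.1 ht1 hT)

lemma exists_continuous_eq_one_sub_exp_div :
    ∃ g : ℝ → ℝ, Continuous g ∧ ∀ u, u ≠ 0 → g u = (1 - Real.exp (-u)) / u := by
  have hd : Differentiable ℝ (fun u : ℝ => 1 - Real.exp (-u)) := by fun_prop
  refine ⟨dslope (fun u : ℝ => 1 - Real.exp (-u)) 0, ?_, fun u hu => ?_⟩
  · rw [← continuousOn_univ, continuousOn_dslope Filter.univ_mem]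
    exact ⟨hd.continuous.continuousOn, hd 0⟩
  · rw [dslope_of_ne _ hu, slope_def_field]
    simp

lemma intervalIntegrable_one_sub_exp_div (a b : ℝ) :
    IntervalIntegrable (fun u => (1 - Real.exp (-u)) / u) volume a b := by
  obtain ⟨g, hg, hgu⟩ := exists_continuous_eq_one_sub_exp_div
  refine (hg.intervalIntegrable a b).congr_ae ?_
  filter_upwards [ae_restrict_of_ae (volume.ae_ne (0 : ℝ))] with u hu using hgu u hu

lemma integral_one_sub_exp_div {T : ℝ} (hT : 0 ≤ T) :
    ∫ u in (0:ℝ)..T, (1 - Real.exp (-u)) / u =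
      (1 - Real.exp (-T)) * Real.log T - ∫ u in (0:ℝ)..T, Real.exp (-u) * Real.log u := by
  obtain ⟨g, hg, hgu⟩ := exists_continuous_eq_one_sub_exp_div
  have hi1 := intervalIntegrable_one_sub_exp_div 0 T
  have hi2 : IntervalIntegrable (fun u => Real.exp (-u) * Real.log u) volume 0 T :=
    intervalIntegrable_log'.continuousOn_mul (by fun_prop)
  have hc : Continuous fun u => (1 - Real.exp (-u)) * Real.log u := by
    convert! hg.mul Real.continuous_mul_log using 1
    ext u
    rcases eq_or_ne u 0 with rfl | hu
    · simp
    · rw [Pi.mul_apply, hgu u hu]; field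
  have h := integral_eq_sub_of_hasDerivAt_of_le hT hc.continuousOn
    (f' := fun u => Real.exp (-u) * Real.log u + (1 - Real.exp (-u)) / u) ?_ (hi2.add hi1)
  · rw [integral_add hi2 hi1] at h
    simp at h
    linarith
  · intro u hu
    have he : HasDerivAt (fun u => 1 - Real.exp (-u)) (Real.exp (-u)) u := by
      simpa using ((hasDerivAt_id u).neg.exp).const_sub 1
    simpa [div_eq_mul_inv] using! he.mul (Real.hasDerivAt_log hu.1.ne')

lemma abs_integral_Ioi_exp_neg_mul_log_le {T : ℝ} (hT : 1 ≤ T) :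
    |∫ u in Set.Ioi T, Real.exp (-u) * Real.log u| ≤ (T + 1) * Real.exp (-T) := by
  have hd : ∀ u ∈ Set.Ici T,
      HasDerivAt (fun u => -((u + 1) * Real.exp (-u))) (u * Real.exp (-u)) u := by
    intro u _
    convert! (((hasDerivAt_id u).add_const 1).mul (hasDerivAt_id u).neg.exp).neg using 1
    simp
    ring
  have hl : Filter.Tendsto (fun u => -((u + 1) * Real.exp (-u))) Filter.atTop (nhds 0) := by
    have h1 := Real.tendsto_pow_mul_exp_neg_atTop_nhds_zero 1
    have h2 := Real.tendsto_pow_mul_exp_neg_atTop_nhds_zero 0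
    simpa [add_mul] using (h1.add h2).neg
  have hn : ∀ u ∈ Set.Ioi T, 0 ≤ u * Real.exp (-u) := fun u hu =>
    mul_nonneg (by linarith [Set.mem_Ioi.1 hu]) (Real.exp_nonneg _)
  have hv := integral_Ioi_of_hasDerivAt_of_nonneg' hd hn hl
  have h := MeasureTheory.norm_integral_le_of_norm_le (μ := volume.restrict (Set.Ioi T))
    (f := fun u => Real.exp (-u) * Real.log u) (g := fun u => u * Real.exp (-u))
    (integrableOn_Ioi_deriv_of_nonneg' hd hn hl) ?_
  · rw [hv] at h
    simpa using h
  · filter_upwards [ae_restrict_mem measurableSet_Ioi] with u hu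
    have hu : T < u := hu
    have := Real.log_le_sub_one_of_pos (by linarith : 0 < u)
    rw [norm_mul, Real.norm_eq_abs, Real.norm_eq_abs, Real.abs_exp, mul_comm,
      abs_of_nonneg (Real.log_nonneg (by linarith))]
    gcongr
    linarith

lemma abs_integral_one_sub_exp_div_sub_le {T : ℝ} (hT : 1 ≤ T) :
    |(∫ u in (0:ℝ)..T, (1 - Real.exp (-u)) / u) -
      (Real.log T + Real.eulerMascheroniConstant)| ≤ (2 * T + 1) * Real.exp (-T) := by
  obtain ⟨hi, hv⟩ := integral_exp_neg_mul_log
  have h := integral_interval_add_Ioi hi (hi.mono_set (Set.Ioi_subset_Ioi (by linarith : 0 ≤ T)))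
  have htail := abs_le.1 (abs_integral_Ioi_exp_neg_mul_log_le hT)
  have hlog : 0 ≤ Real.exp (-T) * Real.log T :=
    mul_nonneg (Real.exp_nonneg _) (Real.log_nonneg hT)
  have hlog' : Real.exp (-T) * Real.log T ≤ Real.exp (-T) * T := by
    gcongr
    linarith [Real.log_le_sub_one_of_pos (by linarith : 0 < T)]
  have hTe : 0 ≤ Real.exp (-T) * T := by positivity
  rw [integral_one_sub_exp_div (by linarith), abs_le]
  constructor <;> nlinarith

lemma integral_one_sub_exp_mul_div {T : ℝ} (hT : T ≠ 0) :
    IntervalIntegrable (fun t => (1 - Real.exp (-(t * T))) / t) volume 0 1 ∧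
    ∫ t in (0:ℝ)..1, (1 - Real.exp (-(t * T))) / t =
      ∫ u in (0:ℝ)..T, (1 - Real.exp (-u)) / u := by
  have e : (fun t => (1 - Real.exp (-(t * T))) / t) =
      fun t => T * ((1 - Real.exp (-(t * T))) / (t * T)) := by
    ext t
    rcases eq_or_ne t 0 with rfl | ht
    · simp
    · field
  rw [e]
  constructor
  · have := (intervalIntegrable_one_sub_exp_div 0 T).comp_mul_right (c := T)
    simpa [hT] using this.const_mul T
  · rw [intervalIntegral.integral_const_mul,
      integral_comp_mul_right (fun u => (1 - Real.exp (-u)) / u) hT]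
    simp [hT]

lemma integrand_eq {t T : ℝ} (h0 : 0 < t) (h1 : t < 1) :
    (1 / √(1 - t)) * ((1 - Real.exp (-(t * T))) / t) =
      (1 - Real.exp (-(t * T))) / t + 1 / (√(1 - t) * (1 + √(1 - t)))
        - Real.exp (-(t * T)) * (1 / 2 + 3 * t / 8)
        - Real.exp (-(t * T)) *
          (1 / (√(1 - t) * (1 + √(1 - t))) - (1 / 2 + 3 * t / 8)) := by
  have hs : 0 < √(1 - t) := Real.sqrt_pos.2 (by linarith)
  have ht : t = (1 - √(1 - t)) * (1 + √(1 - t)) := by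
    ring_nf; rw [Real.sq_sqrt (by linarith)]; ring
  have key : 1 / √(1 - t) * (1 / t) = 1 / t + 1 / (√(1 - t) * (1 + √(1 - t))) := by
    field_simp
    linear_combination -ht
  linear_combination (1 - Real.exp (-(t * T))) * key

lemma integral_eq_add_sub {T : ℝ} (hT : 0 < T) :
    ∫ t in (0:ℝ)..1, (1 / √(1 - t)) * ((1 - Real.exp (-(t * T))) / t) =
      (∫ u in (0:ℝ)..T, (1 - Real.exp (-u)) / u) + 2 * Real.log 2
        - (1 / (2 * T) + 3 / (8 * T ^ 2) - Real.exp (-T) * (7 / (8 * T) + 3 / (8 * T ^ 2)))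
        - ∫ t in (0:ℝ)..1, Real.exp (-(t * T)) *
          (1 / (√(1 - t) * (1 + √(1 - t))) - (1 / 2 + 3 * t / 8)) := by
  obtain ⟨hi1, hv1⟩ := integral_one_sub_exp_mul_div hT.ne'
  obtain ⟨hi2, hv2⟩ := integral_one_div_sqrt_mul
  have hi3 : IntervalIntegrable (fun t => Real.exp (-(t * T)) * (1 / 2 + 3 * t / 8)) volume 0 1 :=
    Continuous.intervalIntegrable (by fun_prop) _ _
  have hi4 : IntervalIntegrable (fun t => Real.exp (-(t * T)) *
      (1 / (√(1 - t) * (1 + √(1 - t))) - (1 / 2 + 3 * t / 8))) volume 0 1 :=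
    (hi2.sub (Continuous.intervalIntegrable (by fun_prop) _ _)).continuousOn_mul (by fun_prop)
  rw [integral_congr_Ioo_of_le zero_le_one fun t ht => integrand_eq ht.1 ht.2,
    integral_sub ((hi1.add hi2).sub hi3) hi4, integral_sub (hi1.add hi2) hi3,
    integral_add hi1 hi2, hv1, hv2, integral_exp_mul_affine hT]

theorem stmt_13 :
    ∃ M c : ℝ, ∀ T > c,
      |(∫ t in (0:ℝ)..1, (1 / Real.sqrt (1 - t)) * ((1 - Real.exp (-(t * T))) / t)) -
          (Real.log T + 2 * Real.log 2 + Real.eulerMascheroniConstant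
            - 1 / (2 * T) - 3 / (8 * T ^ 2))|
        ≤ M * T ^ (-3 : ℝ) := by
  refine ⟨134, 1, fun T hT => ?_⟩
  have hT0 : 0 < T := by linarith
  have hexp : Real.exp (-T) ≤ 24 / T ^ 4 := by
    have := Real.pow_div_factorial_le_exp T hT0.le 4
    rw [Real.exp_neg, inv_le_comm₀ (Real.exp_pos _) (by positivity), inv_div]
    norm_num [Nat.factorial] at this
    exact this
  have hexpT : T * Real.exp (-T) ≤ 24 / T ^ 3 :=
    calc T * Real.exp (-T) ≤ T * (24 / T ^ 4) := by gcongr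
      _ = 24 / T ^ 3 := by field
  have hle : Real.exp (-T) ≤ T * Real.exp (-T) :=
    le_mul_of_one_le_left (Real.exp_nonneg _) hT.le
  have hb0 : 0 ≤ Real.exp (-T) * (7 / (8 * T) + 3 / (8 * T ^ 2)) := by positivity
  have hb : Real.exp (-T) * (7 / (8 * T) + 3 / (8 * T ^ 2)) ≤ Real.exp (-T) * 2 := by
    gcongr
    have h1 : 7 / (8 * T) ≤ 1 := by rw [div_le_one (by positivity)]; linarith
    have h2 : 3 / (8 * T ^ 2) ≤ 1 := by rw [div_le_one (by positivity)]; nlinarith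
    linarith
  have hE := abs_le.1 (abs_integral_one_sub_exp_div_sub_le hT.le)
  have hR := abs_le.1 (abs_integral_remainder_le hT0)
  have hpow : 134 * T ^ (-3 : ℝ) = 5 * (24 / T ^ 3) + 14 / T ^ 3 := by
    rw [Real.rpow_neg hT0.le, show (3 : ℝ) = (3 : ℕ) by norm_num, Real.rpow_natCast]
    ring
  rw [integral_eq_add_sub hT0, hpow, abs_le]
  constructor <;> nlinarith
end

section
/- As T → ∞, ∫_{{0 ≤ x ≤ z ≤ T}} e^{x−z} x^{−1/2} z^{−1/2} dx dz = log T + 2·log 2 + γ − 1/(2T) − 3/(8T²) + O(T^{−3}), where γ is the Euler–Mascheroni constant. -/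
open Real MeasureTheory

open Set intervalIntegral

/-- The continuous extension of `t ↦ (1 - exp (-t)) / t`. -/
noncomputable def expQuot : ℝ → ℝ := dslope (fun t => -exp (-t)) 0

lemma mul_expQuot (t : ℝ) : t * expQuot t = 1 - exp (-t) := by
  have h := sub_smul_dslope (fun t : ℝ => -exp (-t)) 0 t
  simp only [sub_zero, smul_eq_mul, neg_zero, exp_zero] at h
  rw [expQuot, h]
  ring

lemma continuous_expQuot : Continuous expQuot := by
  rw [← continuousOn_univ, expQuot, continuousOn_dslope Filter.univ_mem]
  exact ⟨by fun_prop, by fun_prop⟩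

lemma integral_log_mul_exp_neg :
    ∫ t in Ioi (0 : ℝ), log t * exp (-t) = -eulerMascheroniConstant := by
  have h1 := Complex.hasDerivAt_GammaIntegral (s := 1) (by simp)
  have h2 : HasDerivAt Complex.GammaIntegral (-eulerMascheroniConstant) 1 := by
    refine Complex.hasDerivAt_Gamma_one.congr_of_eventuallyEq ?_
    filter_upwards [(isOpen_lt continuous_const Complex.continuous_re).mem_nhds
      (show (0 : ℝ) < (1 : ℂ).re by simp)] with s hs
    exact (Complex.Gamma_eq_integral hs).symm
  have h3 := h1.unique h2
  simp only [sub_self, Complex.cpow_zero, one_mul] at h3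
  norm_cast at h3

lemma integrableOn_log_mul_exp_neg :
    IntegrableOn (fun t => log t * exp (-t)) (Ioi (0 : ℝ)) := by
  by_contra h
  have h1 := integral_log_mul_exp_neg
  rw [integral_undef h] at h1
  linarith [one_half_lt_eulerMascheroniConstant]

lemma integral_expQuot {T : ℝ} (hT : 0 < T) :
    ∫ t in (0)..T, expQuot t = log T + eulerMascheroniConstant - exp (-T) * log T
      + ∫ t in Ioi T, log t * exp (-t) := by
  have hi : IntervalIntegrable (fun t => log t * exp (-t)) volume 0 T :=
    (intervalIntegrable_iff_integrableOn_Ioc_of_le hT.le).2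
      (integrableOn_log_mul_exp_neg.mono_set Ioc_subset_Ioi_self)
  have hc : Continuous fun t => expQuot t * (t * log t) :=
    continuous_expQuot.mul continuous_mul_log
  have hN : IntervalIntegrable expQuot volume 0 T := continuous_expQuot.intervalIntegrable _ _
  have h1 := integral_eq_sub_of_hasDerivAt_of_le (f := fun t => expQuot t * (t * log t))
    (f' := fun t => log t * exp (-t) + expQuot t) hT.le hc.continuousOn ?_ (hi.add hN)
  · rw [intervalIntegral.integral_add hi hN] at h1
    have h2 := integral_Ioi_sub_Ioi integrableOn_log_mul_exp_neg hT.le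
    rw [integral_log_mul_exp_neg] at h2
    have h3 : expQuot T * (T * log T) = (1 - exp (-T)) * log T := by
      rw [← mul_expQuot]; ring
    simp only [h3, zero_mul, mul_zero, sub_zero] at h1
    linarith
  · intro t ht
    have h4 : (fun t => expQuot t * (t * log t)) = fun t => (1 - exp (-t)) * log t := by
      ext t
      rw [← mul_expQuot]; ring
    rw [h4]
    have h5 := ((((hasDerivAt_id t).neg.exp).const_sub 1).mul (hasDerivAt_log ht.1.ne'))
    refine h5.congr_deriv ?_
    have := mul_expQuot t
    have ht0 : t ≠ 0 := ht.1.ne'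
    simp only [id, Pi.neg_apply]
    rw [← this]
    field_simp

lemma integral_Ioi_log_mul_exp_neg_bounds {T : ℝ} (hT : 1 ≤ T) :
    |∫ t in Ioi T, log t * exp (-t)| ≤ (T + 1) * exp (-T) := by
  have hd : ∀ t ∈ Ioi T, HasDerivAt (fun t => -(t + 1) * exp (-t)) (t * exp (-t)) t := by
    intro t _
    have := (((hasDerivAt_id t).add_const 1).neg).mul ((hasDerivAt_id t).neg.exp)
    refine this.congr_deriv ?_
    simp only [id, Pi.neg_apply]
    ring
  have hlim : Filter.Tendsto (fun t : ℝ => -(t + 1) * exp (-t)) Filter.atTop (nhds 0) := by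
    have h1 := tendsto_pow_mul_exp_neg_atTop_nhds_zero 1
    have h2 := tendsto_pow_mul_exp_neg_atTop_nhds_zero 0
    have := (h1.add h2).neg
    simp only [add_zero, neg_zero] at this
    refine this.congr fun t => ?_
    ring
  have hpos : ∀ t ∈ Ioi T, 0 ≤ t * exp (-t) := fun t ht =>
    mul_nonneg (by linarith [mem_Ioi.1 ht]) (exp_pos _).le
  have hcont : ContinuousWithinAt (fun t : ℝ => -(t + 1) * exp (-t)) (Ici T) T :=
    Continuous.continuousWithinAt (by fun_prop)
  have hint := integrableOn_Ioi_deriv_of_nonneg hcont hd hpos hlim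
  have heq := integral_Ioi_of_hasDerivAt_of_tendsto hcont hd hint hlim
  rw [show (T + 1) * exp (-T) = 0 - -(T + 1) * exp (-T) by ring, ← heq, ← Real.norm_eq_abs]
  refine norm_integral_le_of_norm_le hint ?_
  refine (ae_restrict_iff' measurableSet_Ioi).2 (.of_forall fun t ht => ?_)
  have ht1 : 1 < t := lt_of_le_of_lt hT ht
  rw [Real.norm_eq_abs, abs_of_nonneg (mul_nonneg (log_nonneg ht1.le) (exp_pos _).le)]
  gcongr
  exact log_le_self (by linarith)

lemma integral_exp_mul_inv_bound {T : ℝ} (hT : 1 ≤ T) :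
    |(∫ v in (0 : ℝ)..1, 2 / (1 + v) * exp (-(T * (1 - v ^ 2)))) -
      (1 / (2 * T) + 3 / (8 * T ^ 2))| ≤ 10 / T ^ 3 + exp (-T) * (2 / T) := by
  have hT0 : 0 < T := by linarith
  have hv : ∀ v ∈ uIcc (0 : ℝ) 1, 1 + v ≠ 0 := fun v hv => by
    rw [uIcc_of_le zero_le_one] at hv
    linarith [hv.1]
  have hi1 : IntervalIntegrable (fun v : ℝ => 2 / (1 + v) * exp (-(T * (1 - v ^ 2))))
      volume 0 1 := by
    refine ContinuousOn.intervalIntegrable ?_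
    refine ContinuousOn.mul (ContinuousOn.div (by fun_prop) (by fun_prop) hv) (by fun_prop)
  have hi2 : IntervalIntegrable
      (fun v : ℝ => (v + 3 / 4 * v * (1 - v ^ 2)) * exp (-(T * (1 - v ^ 2)))) volume 0 1 :=
    Continuous.intervalIntegrable (by fun_prop) _ _
  have hmain : ∫ v in (0 : ℝ)..1, (v + 3 / 4 * v * (1 - v ^ 2)) * exp (-(T * (1 - v ^ 2)))
      = (1 / (2 * T) + 3 / (8 * T ^ 2))
        - (1 / (2 * T) + 3 / 8 * (1 / T + 1 / T ^ 2)) * exp (-T) := by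
    rw [integral_eq_sub_of_hasDerivAt (f := fun v : ℝ =>
      (1 / (2 * T) + 3 / 8 * ((1 - v ^ 2) / T + 1 / T ^ 2)) * exp (-(T * (1 - v ^ 2)))) _ hi2]
    · norm_num
      field_simp
    · intro v _
      have h1 : HasDerivAt (fun v : ℝ => 1 - v ^ 2) (-(2 * v)) v := by
        simpa using (hasDerivAt_pow 2 v).const_sub 1
      have h2 := ((((h1.div_const T).add_const (1 / T ^ 2)).const_mul (3 / 8)).const_add
        (1 / (2 * T))).mul ((h1.const_mul T).neg.exp)
      refine h2.congr_deriv ?_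
      simp only [Pi.neg_apply]
      field_simp
      ring
  have hi3 : IntervalIntegrable
      (fun v : ℝ => 5 * ((1 - v) ^ 2 * exp (-(T * (1 - v))))) volume 0 1 :=
    Continuous.intervalIntegrable (by fun_prop) _ _
  have hrem : ∫ v in (0 : ℝ)..1, 5 * ((1 - v) ^ 2 * exp (-(T * (1 - v)))) ≤ 10 / T ^ 3 := by
    rw [integral_eq_sub_of_hasDerivAt (f := fun v : ℝ =>
      5 * (((1 - v) ^ 2 / T + 2 / T ^ 2 * (1 - v) + 2 / T ^ 3) * exp (-(T * (1 - v))))) _ hi3]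
    · have : 0 ≤ 5 * ((1 / T + 2 / T ^ 2 + 2 / T ^ 3) * exp (-T)) := by positivity
      norm_num
      have h : 5 * (2 / T ^ 3) = 10 / T ^ 3 := by ring
      norm_num at this
      linarith
    · intro v _
      have h1 : HasDerivAt (fun v : ℝ => 1 - v) (-1) v := by
        simpa using (hasDerivAt_id v).const_sub 1
      have h2 := ((((((h1.pow 2).div_const T).add (h1.const_mul (2 / T ^ 2))).add_const
        (2 / T ^ 3))).mul ((h1.const_mul T).neg.exp)).const_mul 5
      refine h2.congr_deriv ?_
      simp only [Pi.neg_apply, Pi.add_apply, Pi.pow_apply]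
      field_simp
      ring
  have hdiff : |(∫ v in (0 : ℝ)..1, 2 / (1 + v) * exp (-(T * (1 - v ^ 2)))) -
      ∫ v in (0 : ℝ)..1, (v + 3 / 4 * v * (1 - v ^ 2)) * exp (-(T * (1 - v ^ 2)))|
      ≤ 10 / T ^ 3 := by
    rw [← intervalIntegral.integral_sub hi1 hi2]
    refine le_trans ?_ hrem
    rw [← Real.norm_eq_abs]
    refine norm_integral_le_of_norm_le zero_le_one (.of_forall fun v hv => ?_) hi3
    obtain ⟨hv0, hv1⟩ := hv
    have hv' : 1 + v ≠ 0 := by linarith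
    have h1 : 2 / (1 + v) * exp (-(T * (1 - v ^ 2)))
        - (v + 3 / 4 * v * (1 - v ^ 2)) * exp (-(T * (1 - v ^ 2)))
        = (2 + 9 / 4 * v + 3 / 4 * v ^ 2) / (1 + v)
          * ((1 - v) ^ 2 * exp (-(T * (1 - v ^ 2)))) := by
      field_simp
      ring
    rw [h1, Real.norm_eq_abs, abs_of_nonneg (by positivity)]
    have h2 : (2 + 9 / 4 * v + 3 / 4 * v ^ 2) / (1 + v) ≤ 5 := by
      rw [div_le_iff₀ (by linarith)]
      nlinarith
    have h3 : T * (1 - v) ≤ T * (1 - v ^ 2) := by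
      gcongr
      nlinarith
    gcongr
  have hsmall : |(1 / (2 * T) + 3 / 8 * (1 / T + 1 / T ^ 2)) * exp (-T)|
      ≤ exp (-T) * (2 / T) := by
    rw [abs_of_nonneg (by positivity), mul_comm]
    gcongr
    have : 1 / T ^ 2 ≤ 1 / T := by
      gcongr
      nlinarith
    have h2 : 1 / (2 * T) = 1 / 2 * (1 / T) := by ring
    have h3 : 2 / T = 2 * (1 / T) := by ring
    have h4 : 0 < 1 / T := by positivity
    linarith
  rw [hmain] at hdiff
  rw [abs_le] at *
  constructor <;> linarith [hdiff.1, hdiff.2, hsmall.1, hsmall.2]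

lemma integral_two_mul_expQuot (T : ℝ) :
    ∫ v in (0 : ℝ)..1, 2 * T * expQuot (T * (1 - v ^ 2))
      = (∫ t in (0)..T, expQuot t) + 2 * log 2
        - ∫ v in (0 : ℝ)..1, 2 / (1 + v) * exp (-(T * (1 - v ^ 2))) := by
  have hv : ∀ v ∈ uIcc (0 : ℝ) 1, 1 + v ≠ 0 := fun v hv => by
    rw [uIcc_of_le zero_le_one] at hv
    linarith [hv.1]
  have hi1 : IntervalIntegrable (fun v : ℝ => 2 / (1 + v) * exp (-(T * (1 - v ^ 2))))
      volume 0 1 := by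
    refine ContinuousOn.intervalIntegrable ?_
    refine ContinuousOn.mul (ContinuousOn.div (by fun_prop) (by fun_prop) hv) (by fun_prop)
  have hi2 : IntervalIntegrable (fun v : ℝ => 2 / (1 + v)) volume 0 1 :=
    ContinuousOn.intervalIntegrable (ContinuousOn.div (by fun_prop) (by fun_prop) hv)
  have hi3 : IntervalIntegrable (fun v : ℝ => expQuot (T * (1 - v ^ 2)) * (-(T * (2 * v))))
      volume 0 1 :=
    Continuous.intervalIntegrable
      ((continuous_expQuot.comp (by fun_prop)).mul (by fun_prop)) _ _
  have hsub : ∫ v in (0 : ℝ)..1, expQuot (T * (1 - v ^ 2)) * (-(T * (2 * v)))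
      = -∫ t in (0)..T, expQuot t := by
    have := integral_comp_mul_deriv (a := 0) (b := 1) (f := fun v => T * (1 - v ^ 2))
      (f' := fun v => -(T * (2 * v))) (g := expQuot) ?_ (by fun_prop) continuous_expQuot
    · simp only [Function.comp_def] at this
      rw [this, integral_symm]
      norm_num
    · intro v _
      have h1 : HasDerivAt (fun v : ℝ => 1 - v ^ 2) (-(2 * v)) v := by
        simpa using (hasDerivAt_pow 2 v).const_sub 1
      exact (h1.const_mul T).congr_deriv (by ring)
  have hlog : ∫ v in (0 : ℝ)..1, 2 / (1 + v) = 2 * log 2 := by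
    rw [integral_eq_sub_of_hasDerivAt (f := fun v : ℝ => 2 * log (1 + v)) _ hi2]
    · norm_num
    · intro v hv'
      have := (((hasDerivAt_id v).const_add 1).log (hv v hv')).const_mul 2
      exact this.congr_deriv (by simp; ring)
  have hpt : ∀ v ∈ uIcc (0 : ℝ) 1, 2 * T * expQuot (T * (1 - v ^ 2))
      = 2 / (1 + v) - 2 / (1 + v) * exp (-(T * (1 - v ^ 2)))
        - expQuot (T * (1 - v ^ 2)) * (-(T * (2 * v))) := by
    intro v hv'
    have h1 := mul_expQuot (T * (1 - v ^ 2))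
    have h2 := hv v hv'
    have h3 : exp (-(T * (1 - v ^ 2))) = 1 - T * (1 - v ^ 2) * expQuot (T * (1 - v ^ 2)) := by
      linarith
    rw [h3]
    field_simp
    ring
  rw [integral_congr hpt, intervalIntegral.integral_sub (hi2.sub hi1) hi3,
    intervalIntegral.integral_sub hi2 hi1, hsub, hlog]
  ring

lemma lintegral_exp_mul_rpow {z : ℝ} (hz : 0 < z) :
    ∫⁻ x in Icc 0 z, ENNReal.ofReal (exp (x - z) * x ^ (-(1/2) : ℝ) * z ^ (-(1/2) : ℝ))
      = ∫⁻ v in Ioo (0 : ℝ) 1, ENNReal.ofReal (2 * exp (-(z * (1 - v ^ 2)))) := by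
  have himg : Ioo 0 z = (fun v => z * v ^ 2) '' Ioo (0 : ℝ) 1 := by
    ext x
    constructor
    · rintro ⟨h0, h1⟩
      refine ⟨√(x / z), ⟨by positivity, ?_⟩, ?_⟩
      · rw [sqrt_lt' one_pos, one_pow, div_lt_one hz]
        exact h1
      · simp only
        rw [sq_sqrt (by positivity)]
        field_simp
    · rintro ⟨v, ⟨h0, h1⟩, rfl⟩
      refine ⟨by positivity, ?_⟩
      simp only
      nlinarith [mul_pos hz (show 0 < 1 - v ^ 2 by nlinarith)]
  rw [← setLIntegral_congr Ioo_ae_eq_Icc, himg,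
    lintegral_image_eq_lintegral_abs_deriv_mul (f' := fun v => z * (2 * v)) measurableSet_Ioo]
  · refine setLIntegral_congr_fun measurableSet_Ioo fun v hv => ?_
    have hv0 : 0 < v := hv.1
    rw [← ENNReal.ofReal_mul (abs_nonneg _), abs_of_pos (by positivity)]
    congr 1
    have h1 : (z * v ^ 2) ^ (-(1/2) : ℝ) = z ^ (-(1/2) : ℝ) * v⁻¹ := by
      rw [mul_rpow hz.le (by positivity), ← rpow_natCast, ← rpow_mul hv0.le]
      norm_num
      exact Or.inl (rpow_neg_one v)
    have h2 : z ^ (-(1/2) : ℝ) * z ^ (-(1/2) : ℝ) = z⁻¹ := by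
      rw [← rpow_add hz]
      norm_num
      exact rpow_neg_one z
    rw [h1, show z * v ^ 2 - z = -(z * (1 - v ^ 2)) by ring]
    calc _ = 2 * exp (-(z * (1 - v ^ 2))) * (z * (z ^ (-(1/2) : ℝ) * z ^ (-(1/2) : ℝ)))
          * (v * v⁻¹) := by ring
      _ = _ := by rw [h2, mul_inv_cancel₀ hz.ne', mul_inv_cancel₀ hv0.ne']; ring
  · intro v _
    have := ((hasDerivAt_pow 2 v).const_mul z).hasDerivWithinAt (s := Ioo 0 1)
    exact this.congr_deriv (by norm_num)
  · intro a ha b hb hab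
    have h : a ^ 2 = b ^ 2 := mul_left_cancel₀ hz.ne' hab
    exact (pow_left_inj₀ ha.1.le hb.1.le two_ne_zero).1 h

lemma lintegral_two_mul_exp {T c : ℝ} (hT : 0 < T) (hc : 0 < c) :
    ∫⁻ z in Ioc 0 T, ENNReal.ofReal (2 * exp (-(z * c)))
      = ENNReal.ofReal (2 * T * expQuot (T * c)) := by
  have hcont : Continuous fun z : ℝ => 2 * exp (-(z * c)) := by fun_prop
  have hint := hcont.intervalIntegrable (μ := volume) 0 T
  rw [← ofReal_integral_eq_lintegral_ofReal
    ((intervalIntegrable_iff_integrableOn_Ioc_of_le hT.le).1 hint)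
    (.of_forall fun z => by simp only [Pi.zero_apply]; positivity),
    ← integral_of_le hT.le,
    integral_eq_sub_of_hasDerivAt (f := fun z => -2 / c * exp (-(z * c))) _ hint]
  · congr 1
    have := mul_expQuot (T * c)
    have h : 2 * T * expQuot (T * c) = 2 / c * (T * c * expQuot (T * c)) := by field_simp
    rw [h, this]
    simp only [zero_mul, neg_zero, exp_zero]
    ring
  · intro z _
    refine ((((hasDerivAt_id z).mul_const c).neg.exp).const_mul (-2 / c)).congr_deriv ?_
    simp only [id, Pi.neg_apply]
    field_simp

lemma setIntegral_exp_mul_rpow {T : ℝ} (hT : 0 < T) :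
    ∫ p : ℝ × ℝ in {p : ℝ × ℝ | 0 ≤ p.1 ∧ p.1 ≤ p.2 ∧ p.2 ≤ T},
        exp (p.1 - p.2) * p.1 ^ (-(1/2) : ℝ) * p.2 ^ (-(1/2) : ℝ)
      = ∫ v in (0 : ℝ)..1, 2 * T * expQuot (T * (1 - v ^ 2)) := by
  set S : Set (ℝ × ℝ) := {p : ℝ × ℝ | 0 ≤ p.1 ∧ p.1 ≤ p.2 ∧ p.2 ≤ T} with hS_def
  have hS : MeasurableSet S :=
    (measurableSet_le measurable_const measurable_fst).inter
      ((measurableSet_le measurable_fst measurable_snd).inter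
        (measurableSet_le measurable_snd measurable_const))
  have hf : Measurable fun p : ℝ × ℝ =>
      exp (p.1 - p.2) * p.1 ^ (-(1/2) : ℝ) * p.2 ^ (-(1/2) : ℝ) := by fun_prop
  have hslice : ∀ᵐ z : ℝ, ∫⁻ x, S.indicator (fun p : ℝ × ℝ => ENNReal.ofReal
      (exp (p.1 - p.2) * p.1 ^ (-(1/2) : ℝ) * p.2 ^ (-(1/2) : ℝ))) (x, z)
      = (Ioc 0 T).indicator (fun z => ∫⁻ v in Ioo (0 : ℝ) 1,
          ENNReal.ofReal (2 * exp (-(z * (1 - v ^ 2))))) z := by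
    filter_upwards [Measure.ae_ne volume (0 : ℝ)] with z hz0
    by_cases hz : z ∈ Ioc 0 T
    · rw [indicator_of_mem hz, ← lintegral_exp_mul_rpow hz.1, ← lintegral_indicator
        measurableSet_Icc]
      refine lintegral_congr fun x => ?_
      by_cases hx : x ∈ Icc 0 z
      · rw [indicator_of_mem hx, indicator_of_mem (show (x, z) ∈ S from ⟨hx.1, hx.2, hz.2⟩)]
      · rw [indicator_of_notMem hx, indicator_of_notMem]
        exact fun h => hx ⟨h.1, h.2.1⟩
    · rw [indicator_of_notMem hz, lintegral_eq_zero_of_ae_eq_zero]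
      refine .of_forall fun x => indicator_of_notMem (fun h => hz ?_) _
      exact ⟨lt_of_le_of_ne (h.1.trans h.2.1) hz0.symm, h.2.2⟩
  rw [integral_eq_lintegral_of_nonneg_ae _ hf.aestronglyMeasurable,
    ← lintegral_indicator hS, Measure.volume_eq_prod, lintegral_prod_symm' _
      (hf.ennreal_ofReal.indicator hS), lintegral_congr_ae hslice,
    lintegral_indicator measurableSet_Ioc, lintegral_lintegral_swap,
    setLIntegral_congr_fun (g := fun v => ENNReal.ofReal (2 * T * expQuot (T * (1 - v ^ 2))))
      measurableSet_Ioo fun v hv => lintegral_two_mul_exp hT (by nlinarith [hv.1, hv.2]),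
    integral_of_le zero_le_one, integral_Ioc_eq_integral_Ioo, integral_eq_lintegral_of_nonneg_ae]
  · refine (ae_restrict_iff' measurableSet_Ioo).2 (.of_forall fun v hv => ?_)
    have hc : 0 < 1 - v ^ 2 := by nlinarith [hv.1, hv.2]
    have h1 := mul_expQuot (T * (1 - v ^ 2))
    have h2 : 0 < T * (1 - v ^ 2) := by positivity
    have h3 : exp (-(T * (1 - v ^ 2))) ≤ 1 := exp_le_one_iff.2 (by linarith)
    have h4 : 0 ≤ expQuot (T * (1 - v ^ 2)) :=
      nonneg_of_mul_nonneg_right (by linarith) h2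
    simp only [Pi.zero_apply]
    positivity
  · exact (continuous_const.mul
      (continuous_expQuot.comp (by fun_prop))).aestronglyMeasurable
  · exact Measurable.aemeasurable (by unfold Function.uncurry; fun_prop)
  · refine (ae_restrict_iff' hS).2 (.of_forall fun p hp => ?_)
    have h1 := rpow_nonneg hp.1 (-(1/2) : ℝ)
    have h2 := rpow_nonneg (hp.1.trans hp.2.1) (-(1/2) : ℝ)
    simp only [Pi.zero_apply]
    positivity

theorem stmt_14 :
    ∃ M c : ℝ, ∀ T > c,
      |(∫ p : ℝ × ℝ in {p : ℝ × ℝ | 0 ≤ p.1 ∧ p.1 ≤ p.2 ∧ p.2 ≤ T},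
            Real.exp (p.1 - p.2) * p.1 ^ (-(1/2) : ℝ) * p.2 ^ (-(1/2) : ℝ)) -
          (Real.log T + 2 * Real.log 2 + Real.eulerMascheroniConstant
            - 1 / (2 * T) - 3 / (8 * T ^ 2))|
        ≤ M * T ^ (-3 : ℝ) := by
  refine ⟨130, 1, fun T hT => ?_⟩
  have hT0 : 0 < T := by linarith
  have hpow : T ^ (-3 : ℝ) = 1 / T ^ 3 := by
    rw [rpow_neg hT0.le, one_div]
    norm_cast
  have hexp : T * exp (-T) ≤ 24 * (1 / T ^ 3) := by
    have h := pow_div_factorial_le_exp T hT0.le 4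
    norm_num [Nat.factorial] at h
    rw [exp_neg, ← div_eq_mul_inv, mul_one_div, div_le_div_iff₀ (exp_pos _) (by positivity)]
    linarith
  have hE := exp_pos (-T)
  have h1 := integral_Ioi_log_mul_exp_neg_bounds hT.le
  have h2 := integral_exp_mul_inv_bound hT.le
  have h3 : (T + 1) * exp (-T) ≤ 2 * (T * exp (-T)) := by nlinarith
  have h4 : exp (-T) * (2 / T) ≤ 2 * (T * exp (-T)) := by
    rw [mul_div_assoc', div_le_iff₀ hT0]
    nlinarith [mul_pos hE hT0, mul_pos (mul_pos hE hT0) hT0]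
  have h5 : 0 ≤ exp (-T) * log T := mul_nonneg hE.le (log_nonneg hT.le)
  have h6 : exp (-T) * log T ≤ T * exp (-T) := by
    nlinarith [log_le_self hT0.le]
  have h7 : 10 / T ^ 3 = 10 * (1 / T ^ 3) := by ring
  rw [setIntegral_exp_mul_rpow hT0, integral_two_mul_expQuot, integral_expQuot hT0, hpow]
  rw [abs_le] at *
  constructor <;> linarith [h1.1, h1.2, h2.1, h2.2]
end
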